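/- arXiv:2007.10832 — 5 statements merged into one kernel-verified Lean document; each statement's English description precedes it below -/
import Mathlib

section
/- Let h,s∈ℕ, γ>0, and let H be an ordered graph on h vertices. Then there exists n₀∈ℕ such that the following holds. Suppose G is an ordered graph on n ≥ n₀ vertices such that for every pair of vertices x,y ∈ V(G) there are at least γn^{sh−1} sets X ⊆ V(G)∖{x,y} of size sh−1 such that both G[X∪{x}] and G[X∪{y}] contain perfect H-tilings. Then V(G) contains a set M with |M| ≤ (γ/2)^h·n/4 such that M is an H-absorbing set for every W ⊆ V(G)∖M with |W| divisible by h and |W| ≤ (γ/2)^{2h}·n/(32s²h³). -/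
open Finset

section Defs

variable {h n : ℕ}

/-- `φ` is an order-preserving embedding of the ordered graph `H` into the ordered graph `G`:
a strictly increasing map carrying edges of `H` to edges of `G`. -/
def IsOrderedCopy (H : SimpleGraph (Fin h)) (G : SimpleGraph (Fin n))
    (φ : Fin h → Fin n) : Prop :=
  StrictMono φ ∧ ∀ i j : Fin h, H.Adj i j → G.Adj (φ i) (φ j)

/-- `S` is the vertex set of a copy of the ordered graph `H` in the ordered graph `G`. -/
def IsCopySet (H : SimpleGraph (Fin h)) (G : SimpleGraph (Fin n))
    (S : Finset (Fin n)) : Prop :=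
  ∃ φ : Fin h → Fin n, IsOrderedCopy H G φ ∧ Finset.image φ Finset.univ = S

/-- `G` has an `H`-tiling (vertex-disjoint copies of `H`) whose copies exactly cover the
vertex set `S`; equivalently, the induced ordered subgraph `G[S]` has a perfect `H`-tiling. -/
def HasPerfectTilingOn (H : SimpleGraph (Fin h)) (G : SimpleGraph (Fin n))
    (S : Finset (Fin n)) : Prop :=
  ∃ 𝒯 : Finset (Finset (Fin n)),
    (∀ T ∈ 𝒯, IsCopySet H G T) ∧
    (𝒯 : Set (Finset (Fin n))).PairwiseDisjoint id ∧
    𝒯.biUnion id = S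

/-- `G` has a perfect `H`-tiling. -/
def HasPerfectTiling (H : SimpleGraph (Fin h)) (G : SimpleGraph (Fin n)) : Prop :=
  HasPerfectTilingOn H G Finset.univ

/-- The degree of a vertex in an ordered graph. -/
noncomputable def odeg (G : SimpleGraph (Fin n)) (v : Fin n) : ℕ :=
  (G.neighborSet v).ncard

/-- `[h]` can be partitioned into `k` intervals, each independent in `H`
(expressed via a monotone colouring with independent fibres). -/
def HasIntervalColoring (H : SimpleGraph (Fin h)) (k : ℕ) : Prop :=
  ∃ c : Fin h → Fin k, Monotone c ∧ ∀ i j : Fin h, H.Adj i j → c i ≠ c j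

/-- The interval chromatic number `χ<(H)` of an ordered graph. -/
noncomputable def intervalChi (H : SimpleGraph (Fin h)) : ℕ :=
  sInf {k | HasIntervalColoring H k}

/-- `α⁺ᵢ(H)`: `α⁺₀ = 0`, and `α⁺_{i+1}` is the largest `k ≤ h` such that the interval
`[α⁺ᵢ + 1, k]` is independent in `H` (vertices are 1-indexed via `v ↦ (v : ℕ) + 1`). -/
noncomputable def alphaPlus (H : SimpleGraph (Fin h)) : ℕ → ℕ
  | 0 => 0
  | (i + 1) => sSup {k | k ≤ h ∧ ∀ a b : Fin h,
      alphaPlus H i + 1 ≤ (a : ℕ) + 1 → (a : ℕ) + 1 ≤ k →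
      alphaPlus H i + 1 ≤ (b : ℕ) + 1 → (b : ℕ) + 1 ≤ k → ¬ H.Adj a b}

/-- `α⁻ᵢ(H)`: `α⁻₀ = h + 1`, and `α⁻_{i+1}` is the smallest `k ≥ 1` such that the interval
`[k, α⁻ᵢ − 1]` is independent in `H`. -/
noncomputable def alphaMinus (H : SimpleGraph (Fin h)) : ℕ → ℕ
  | 0 => h + 1
  | (i + 1) => sInf {k | 1 ≤ k ∧ ∀ a b : Fin h,
      k ≤ (a : ℕ) + 1 → (a : ℕ) + 1 ≤ alphaMinus H i - 1 →
      k ≤ (b : ℕ) + 1 → (b : ℕ) + 1 ≤ alphaMinus H i - 1 → ¬ H.Adj a b}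

/-- `α*(H) = min over 1 ≤ ℓ < χ<(H) of min{α⁺_ℓ/(ℓh), (h − α⁻_ℓ + 1)/(ℓh)}`. -/
noncomputable def alphaStar (H : SimpleGraph (Fin h)) : ℝ :=
  sInf {x : ℝ | ∃ ℓ : ℕ, 1 ≤ ℓ ∧ ℓ < intervalChi H ∧
    (x = (alphaPlus H ℓ : ℝ) / (ℓ * h) ∨
     x = ((h : ℝ) - alphaMinus H ℓ + 1) / (ℓ * h))}

/-- `α*(H)` for ordered graphs with interval chromatic number 2:
`min{α⁺₁(H)/h, (h − α⁻₁(H) + 1)/h}`. -/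
noncomputable def alphaStar2 (H : SimpleGraph (Fin h)) : ℝ :=
  min ((alphaPlus H 1 : ℝ) / h) (((h : ℝ) - alphaMinus H 1 + 1) / h)

/-- Property A: no edges of `H` within `[1, ⌊h/2⌋ + 1]` nor within `[⌈h/2⌉, h]`. -/
def PropertyA (H : SimpleGraph (Fin h)) : Prop :=
  (∀ a b : Fin h, (a : ℕ) + 1 ≤ h / 2 + 1 → (b : ℕ) + 1 ≤ h / 2 + 1 → ¬ H.Adj a b) ∧
  (∀ a b : Fin h, (h + 1) / 2 ≤ (a : ℕ) + 1 → (h + 1) / 2 ≤ (b : ℕ) + 1 → ¬ H.Adj a b)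

/-- Property B: for each partition of `[h]` into nonempty intervals `[1, i], [i+1, h]`
there is an edge of `H` between them. -/
def PropertyB (H : SimpleGraph (Fin h)) : Prop :=
  ∀ i : ℕ, 1 ≤ i → i < h →
    ∃ a b : Fin h, H.Adj a b ∧ (a : ℕ) + 1 ≤ i ∧ i + 1 ≤ (b : ℕ) + 1

/-- `s(H)`: the smallest vertex adjacent to `h`, and `0` if `h` is isolated. -/
noncomputable def sOG (H : SimpleGraph (Fin h)) : ℕ :=
  sInf {k | ∃ a b : Fin h, H.Adj a b ∧ (a : ℕ) + 1 = k ∧ (b : ℕ) + 1 = h}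

open Classical in
/-- `l(H)`: the largest vertex adjacent to `1`, and `h + 1` if `1` is isolated. -/
noncomputable def lOG (H : SimpleGraph (Fin h)) : ℕ :=
  if ∃ a b : Fin h, H.Adj a b ∧ (a : ℕ) + 1 = 1 then
    sSup {k | ∃ a b : Fin h, H.Adj a b ∧ (a : ℕ) + 1 = 1 ∧ (b : ℕ) + 1 = k}
  else h + 1

/-- The vertex `h` has Property C: `s(H) ≥ 1` and there is an edge within `[s(H), h − 1]`. -/
def PropertyCLast (H : SimpleGraph (Fin h)) : Prop :=
  1 ≤ sOG H ∧ ∃ a b : Fin h, H.Adj a b ∧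
    sOG H ≤ (a : ℕ) + 1 ∧ (a : ℕ) + 1 ≤ h - 1 ∧
    sOG H ≤ (b : ℕ) + 1 ∧ (b : ℕ) + 1 ≤ h - 1

/-- The vertex `1` has Property C: `l(H) ≤ h` and there is an edge within `[2, l(H)]`. -/
def PropertyCFirst (H : SimpleGraph (Fin h)) : Prop :=
  lOG H ≤ h ∧ ∃ a b : Fin h, H.Adj a b ∧
    2 ≤ (a : ℕ) + 1 ∧ (a : ℕ) + 1 ≤ lOG H ∧
    2 ≤ (b : ℕ) + 1 ∧ (b : ℕ) + 1 ≤ lOG H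

/-- `S` is an `H`-absorbing set for `W`: both `G[S]` and `G[S ∪ W]` have perfect `H`-tilings. -/
def IsAbsorbingFor (H : SimpleGraph (Fin h)) (G : SimpleGraph (Fin n))
    (S W : Finset (Fin n)) : Prop :=
  HasPerfectTilingOn H G S ∧ HasPerfectTilingOn H G (S ∪ W)

end Defs

section Regularity

/-- The density `d(A,B) = e(A,B)/(|A||B|)` of a pair of vertex sets in a graph. -/
noncomputable def pairDensity {V : Type*} (G : SimpleGraph V) (A B : Finset V) : ℝ :=
  ({e : V × V | e.1 ∈ A ∧ e.2 ∈ B ∧ G.Adj e.1 e.2}.ncard : ℝ) /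
    ((A.card : ℝ) * (B.card : ℝ))

/-- The pair `(A, B)` is `ε`-regular in `G`. -/
def IsRegularPair {V : Type*} (G : SimpleGraph V) (A B : Finset V) (ε : ℝ) : Prop :=
  ∀ X ⊆ A, ∀ Y ⊆ B, ε * A.card ≤ (X.card : ℝ) → ε * B.card ≤ (Y.card : ℝ) →
    |pairDensity G A B - pairDensity G X Y| < ε

end Regularity

section Bottle

/-- The chromatic number of a finite graph. -/
noncomputable def chromNum {m : ℕ} (B : SimpleGraph (Fin m)) : ℕ :=
  sInf {k | ∃ c : Fin m → Fin k, ∀ x y : Fin m, B.Adj x y → c x ≠ c y}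

/-- `σ(B)`: the smallest size of a colour class in any proper colouring of `B`
with `χ(B)` colours. -/
noncomputable def sigmaMinCl {m : ℕ} (B : SimpleGraph (Fin m)) : ℕ :=
  sInf {c | ∃ C : Fin m → Fin (chromNum B),
    (∀ x y : Fin m, B.Adj x y → C x ≠ C y) ∧
    ∃ i : Fin (chromNum B), c = (Finset.univ.filter (fun v => C v = i)).card}

/-- The critical chromatic number `χ_cr(B) = (χ(B) − 1)·|B|/(|B| − σ(B))`. -/
noncomputable def critChrom {m : ℕ} (B : SimpleGraph (Fin m)) : ℝ :=
  ((chromNum B : ℝ) - 1) * m / ((m : ℝ) - sigmaMinCl B)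

/-- `φ` is an interval labeling of the complete multipartite graph with part function `p`
(with respect to some permutation `σ` of the parts). -/
def IsIntervalLabeling {m k : ℕ} (p : Fin m → Fin k) (φ : Equiv.Perm (Fin m)) : Prop :=
  ∃ σ : Equiv.Perm (Fin k), ∀ x y : Fin m, σ (p x) < σ (p y) → φ x < φ y

/-- `G` is (an isomorphic realisation of) the ordered blow-up `(B(t), φ)` of the complete
multipartite graph `B` with part function `p`: there is a block assignment `β` whose fibres
all have size `t`, compatible with the order induced by `φ`, with adjacency between blocks
given by `B`. -/
def IsOrderedBlowup {m k : ℕ} (p : Fin m → Fin k) (φ : Equiv.Perm (Fin m)) (t : ℕ)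
    {N : ℕ} (G : SimpleGraph (Fin N)) : Prop :=
  ∃ β : Fin N → Fin m,
    (∀ x : Fin m, {u : Fin N | β u = x}.ncard = t) ∧
    (∀ u v : Fin N, u ≤ v → φ (β u) ≤ φ (β v)) ∧
    (∀ u v : Fin N, G.Adj u v ↔ p (β u) ≠ p (β v))

/-- The complete multipartite graph with part function `p` is a bottlegraph assigned to `H`:
for every interval labeling `φ` there is a `t ≥ 1` such that the ordered blow-up `(B(t), φ)`
has a perfect `H`-tiling. -/
def IsBottlegraph {h m k : ℕ} (H : SimpleGraph (Fin h)) (p : Fin m → Fin k) : Prop :=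
  ∀ φ : Equiv.Perm (Fin m), IsIntervalLabeling p φ →
    ∃ t : ℕ, 0 < t ∧ ∀ (N : ℕ) (G : SimpleGraph (Fin N)),
      IsOrderedBlowup p φ t G → HasPerfectTiling H G

end Bottle

section Tilings

variable {h n : ℕ} {H : SimpleGraph (Fin h)} {G : SimpleGraph (Fin n)}

lemma HasPerfectTilingOn.empty : HasPerfectTilingOn H G ∅ :=
  ⟨∅, by simp, by simp, by simp⟩

lemma HasPerfectTilingOn.union {A B : Finset (Fin n)} (hA : HasPerfectTilingOn H G A)
    (hB : HasPerfectTilingOn H G B) (hAB : Disjoint A B) : HasPerfectTilingOn H G (A ∪ B) := by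
  obtain ⟨𝒜, h𝒜, h𝒜d, rfl⟩ := hA
  obtain ⟨ℬ, hℬ, hℬd, rfl⟩ := hB
  refine ⟨𝒜 ∪ ℬ, ?_, ?_, Finset.union_biUnion⟩
  · intro T hT
    rcases Finset.mem_union.1 hT with hT | hT
    exacts [h𝒜 T hT, hℬ T hT]
  · rw [Finset.coe_union, Set.pairwiseDisjoint_union]
    refine ⟨h𝒜d, hℬd, fun S hS T hT _ => ?_⟩
    exact hAB.mono (Finset.subset_biUnion_of_mem id hS) (Finset.subset_biUnion_of_mem id hT)

lemma IsCopySet.hasPerfectTilingOn {S : Finset (Fin n)} (hS : IsCopySet H G S) :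
    HasPerfectTilingOn H G S :=
  ⟨{S}, by simpa using hS, by simp, by simp⟩

lemma IsCopySet.card_eq {S : Finset (Fin n)} (hS : IsCopySet H G S) : S.card = h := by
  obtain ⟨φ, hφ, rfl⟩ := hS
  rw [Finset.card_image_of_injective _ hφ.1.injective, Finset.card_univ, Fintype.card_fin]

/-- A union of pairwise disjoint tiled sets is tiled. -/
lemma HasPerfectTilingOn.biUnion {𝓕 : Finset (Finset (Fin n))}
    (hd : (𝓕 : Set (Finset (Fin n))).PairwiseDisjoint id)
    (ht : ∀ S ∈ 𝓕, HasPerfectTilingOn H G S) : HasPerfectTilingOn H G (𝓕.biUnion id) := by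
  induction 𝓕 using Finset.induction_on with
  | empty => simpa using HasPerfectTilingOn.empty
  | insert S 𝓕 hS ih =>
    rw [Finset.biUnion_insert]
    rw [Finset.coe_insert, Set.pairwiseDisjoint_insert] at hd
    refine (ht S (Finset.mem_insert_self _ _)).union
      (ih hd.1 fun T hT => ht T (Finset.mem_insert_of_mem hT)) ?_
    rw [Finset.disjoint_biUnion_right]
    exact fun T hT => hd.2 T hT (fun hST => hS (hST ▸ hT))

/-- If every `h`-set has at least `t` absorbers in a family of disjoint tiled sets, then the union
of the family absorbs any set of `t * h` further vertices. -/
lemma HasPerfectTilingOn.biUnion_union_of_absorbers (t : ℕ) :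
    ∀ (𝓕 : Finset (Finset (Fin n))) (W : Finset (Fin n)),
      (𝓕 : Set (Finset (Fin n))).PairwiseDisjoint id →
      (∀ S ∈ 𝓕, HasPerfectTilingOn H G S) →
      (∀ Q : Finset (Fin n), Q.card = h →
        ∃ 𝒮 ⊆ 𝓕, t ≤ 𝒮.card ∧ ∀ S ∈ 𝒮, HasPerfectTilingOn H G (S ∪ Q)) →
      Disjoint (𝓕.biUnion id) W → W.card = t * h →
      HasPerfectTilingOn H G (𝓕.biUnion id ∪ W) := by
  induction t with
  | zero =>
    intro 𝓕 W hd ht _ _ hW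
    have : W = ∅ := by simpa using hW
    subst this
    simpa using HasPerfectTilingOn.biUnion hd ht
  | succ t ih =>
    intro 𝓕 W hd ht habs hdW hW
    obtain ⟨Q, hQW, hQ⟩ := Finset.exists_subset_card_eq (s := W) (n := h)
      (by rw [hW]; exact Nat.le_mul_of_pos_left _ (Nat.succ_pos _))
    obtain ⟨𝒮, h𝒮, hcard, hS𝒮⟩ := habs Q hQ
    obtain ⟨S, hS⟩ := Finset.card_pos.1 (lt_of_lt_of_le (Nat.succ_pos t) hcard)
    have hSF := h𝒮 hS
    have hrest : HasPerfectTilingOn H G ((𝓕.erase S).biUnion id ∪ (W \ Q)) := by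
      apply ih
      · exact hd.subset (by simp)
      · exact fun T hT => ht T (Finset.mem_of_mem_erase hT)
      · intro Q' hQ'
        obtain ⟨𝒮', h𝒮', hcard', hS𝒮'⟩ := habs Q' hQ'
        refine ⟨𝒮'.erase S, Finset.erase_subset_erase S h𝒮', ?_,
          fun T hT => hS𝒮' T (Finset.mem_of_mem_erase hT)⟩
        have := Finset.pred_card_le_card_erase (s := 𝒮') (a := S)
        omega
      · exact hdW.mono (Finset.biUnion_subset_biUnion_of_subset_left _ (Finset.erase_subset _ _))
          Finset.sdiff_subset
      · rw [Finset.card_sdiff_of_subset hQW, hW, hQ, Nat.succ_mul]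
        omega
    have hSM : S ⊆ 𝓕.biUnion id := Finset.subset_biUnion_of_mem id hSF
    have hEM : (𝓕.erase S).biUnion id ⊆ 𝓕.biUnion id :=
      Finset.biUnion_subset_biUnion_of_subset_left _ (Finset.erase_subset _ _)
    have hSE : Disjoint S ((𝓕.erase S).biUnion id) := by
      rw [Finset.disjoint_biUnion_right]
      intro T hT
      rw [Finset.mem_erase] at hT
      exact hd hSF hT.2 hT.1.symm
    have heq : 𝓕.biUnion id ∪ W = (S ∪ Q) ∪ ((𝓕.erase S).biUnion id ∪ (W \ Q)) := by
      conv_lhs => rw [← Finset.insert_erase hSF, Finset.biUnion_insert, id]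
      conv_lhs => rw [← Finset.union_sdiff_of_subset hQW]
      exact Finset.union_union_union_comm _ _ _ _
    rw [heq]
    refine (hS𝒮 S hS).union hrest ?_
    rw [Finset.disjoint_union_left, Finset.disjoint_union_right, Finset.disjoint_union_right]
    exact ⟨⟨hSE, hdW.mono hSM Finset.sdiff_subset⟩,
      (hdW.mono hEM hQW).symm, Finset.disjoint_sdiff⟩

end Tilings

section Counting

variable {n : ℕ}

lemma card_powersetCard_univ_le (n k : ℕ) :
    ((Finset.powersetCard k (Finset.univ : Finset (Fin n))).card : ℝ) ≤ (n : ℝ) ^ k := by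
  rw [Finset.card_powersetCard, Finset.card_univ, Fintype.card_fin]
  exact_mod_cast Nat.choose_le_pow n k

open Classical in
/-- A dense family of `k`-sets still contains many sets avoiding a small vertex set. -/
lemma card_filter_disjoint_ge {k : ℕ} {𝒳 : Finset (Finset (Fin n))}
    (h𝒳 : ∀ X ∈ 𝒳, X.card = k) {F : Finset (Fin n)} {γ : ℝ}
    (hγ₀ : 0 ≤ γ) (hγ : γ * (n : ℝ) ^ k ≤ 𝒳.card) (hF : (F.card : ℝ) ≤ γ / 2 * n) :
    γ / 2 * (n : ℝ) ^ k ≤ (𝒳.filter fun X => Disjoint X F).card := by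
  have hsplit : ((𝒳.filter fun X => Disjoint X F).card : ℝ) +
      (𝒳.filter fun X => ¬ Disjoint X F).card = 𝒳.card := by
    exact_mod_cast Finset.card_filter_add_card_filter_not (s := 𝒳) (fun X => Disjoint X F)
  suffices hmeet : ((𝒳.filter fun X => ¬ Disjoint X F).card : ℝ) ≤ γ / 2 * (n : ℝ) ^ k by
    linarith
  rcases k with _ | k
  · have hempty : 𝒳.filter (fun X => ¬ Disjoint X F) = ∅ := by
      refine Finset.filter_eq_empty_iff.2 fun X hX => ?_
      rw [Finset.card_eq_zero.1 (h𝒳 X hX)]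
      simp
    rw [hempty, Finset.card_empty, Nat.cast_zero, pow_zero, mul_one]
    positivity
  · have hsub : 𝒳.filter (fun X => ¬ Disjoint X F) ⊆
        (F ×ˢ Finset.powersetCard k Finset.univ).image fun p => insert p.1 p.2 := by
      intro X hX
      rw [Finset.mem_filter, Finset.not_disjoint_iff] at hX
      obtain ⟨hX, v, hvX, hvF⟩ := hX
      refine Finset.mem_image.2 ⟨(v, X.erase v), ?_, Finset.insert_erase hvX⟩
      rw [Finset.mem_product, Finset.mem_powersetCard_univ, Finset.card_erase_of_mem hvX, h𝒳 X hX]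
      exact ⟨hvF, rfl⟩
    have hle := (Finset.card_le_card hsub).trans Finset.card_image_le
    rw [Finset.card_product] at hle
    calc ((𝒳.filter fun X => ¬ Disjoint X F).card : ℝ)
        ≤ F.card * (Finset.powersetCard k (Finset.univ : Finset (Fin n))).card := by
          exact_mod_cast hle
      _ ≤ γ / 2 * n * (n : ℝ) ^ k := by
          have h0 : (0 : ℝ) ≤ F.card := Nat.cast_nonneg _
          exact mul_le_mul hF (card_powersetCard_univ_le n k) (Nat.cast_nonneg _) (h0.trans hF)
      _ = γ / 2 * (n : ℝ) ^ (k + 1) := by ring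

end Counting

section Fibres

lemma card_mul_le_card_of_fibres {α β δ : Type*} {s : Finset α} {t : α → Finset β}
    {u : Finset δ} (e : α → β → δ) (he : Function.Injective2 e)
    (hmaps : ∀ a ∈ s, ∀ b ∈ t a, e a b ∈ u) {D : ℝ} (hD : ∀ a ∈ s, D ≤ (t a).card) :
    s.card * D ≤ u.card := by
  have hle : (s.sigma t).card ≤ u.card := by
    refine Finset.card_le_card_of_injOn (fun p => e p.1 p.2) ?_ ?_
    · rintro ⟨a, b⟩ hab
      rw [Finset.mem_coe, Finset.mem_sigma] at hab
      exact hmaps a hab.1 b hab.2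
    · rintro ⟨a, b⟩ _ ⟨a', b'⟩ _ hab
      obtain ⟨rfl, rfl⟩ := he hab
      rfl
  calc (s.card : ℝ) * D = ∑ _a ∈ s, D := by rw [Finset.sum_const, nsmul_eq_mul]
    _ ≤ ∑ a ∈ s, ((t a).card : ℝ) := Finset.sum_le_sum hD
    _ = ((s.sigma t).card : ℝ) := by rw [Finset.card_sigma, Nat.cast_sum]
    _ ≤ u.card := by exact_mod_cast hle

end Fibres

section Absorbers

variable {h n : ℕ} {H : SimpleGraph (Fin h)} {G : SimpleGraph (Fin n)}

open Classical in
/-- The `k`-sets that form a tiled set together with `x` as well as together with `y`. -/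
noncomputable def connectors (H : SimpleGraph (Fin h)) (G : SimpleGraph (Fin n)) (k : ℕ)
    (x y : Fin n) : Finset (Finset (Fin n)) :=
  Finset.univ.filter fun X => x ∉ X ∧ y ∉ X ∧ X.card = k ∧
    HasPerfectTilingOn H G (insert x X) ∧ HasPerfectTilingOn H G (insert y X)

lemma mem_connectors {k : ℕ} {x y : Fin n} {X : Finset (Fin n)} :
    X ∈ connectors H G k x y ↔ x ∉ X ∧ y ∉ X ∧ X.card = k ∧
      HasPerfectTilingOn H G (insert x X) ∧ HasPerfectTilingOn H G (insert y X) := by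
  simp [connectors]

lemma biUnion_univ_cons {k : ℕ} (X : Finset (Fin n)) (f : Fin k → Finset (Fin n)) :
    Finset.univ.biUnion (Fin.cons X f : Fin (k + 1) → Finset (Fin n)) =
      X ∪ Finset.univ.biUnion f := by
  ext v
  simp [Fin.exists_fin_succ]

open Classical in
/-- Tuples of connectors that switch between the equally large sets `R` and `Y`. -/
lemma card_switching_tuples_ge {K : ℕ} {γ : ℝ} (hγ : 0 ≤ γ)
    (hconn : ∀ x y, γ * (n : ℝ) ^ K ≤ (connectors H G K x y).card) (F : Finset (Fin n)) (k : ℕ) :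
    ∀ R Y : Finset (Fin n), R.card = k → Y.card = k → R ⊆ F → Y ⊆ F →
      (F.card : ℝ) + k * K ≤ γ / 2 * n →
      (γ / 2 * (n : ℝ) ^ K) ^ k ≤
        ((Finset.univ : Finset (Fin k → Finset (Fin n))).filter fun f =>
          (∀ i, (f i).card = K) ∧ Disjoint (Finset.univ.biUnion f) F ∧
          HasPerfectTilingOn H G (Finset.univ.biUnion f ∪ R) ∧
          HasPerfectTilingOn H G (Finset.univ.biUnion f ∪ Y)).card := by
  induction k with
  | zero =>
    intro R Y hR hY _ _ _
    rw [Finset.card_eq_zero] at hR hY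
    subst hR hY
    simp [HasPerfectTilingOn.empty]
  | succ k ih =>
    intro R Y hR hY hRF hYF hF
    obtain ⟨r, hr⟩ := Finset.card_pos.1 (by rw [hR]; exact Nat.succ_pos k)
    obtain ⟨y, hy⟩ := Finset.card_pos.1 (by rw [hY]; exact Nat.succ_pos k)
    push_cast at hF
    have hK : (0 : ℝ) ≤ K := Nat.cast_nonneg _
    have hind := ih (R.erase r) (Y.erase y) (by rw [Finset.card_erase_of_mem hr, hR]; rfl)
      (by rw [Finset.card_erase_of_mem hy, hY]; rfl) ((Finset.erase_subset _ _).trans hRF)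
      ((Finset.erase_subset _ _).trans hYF) (by linarith)
    have hD : (0 : ℝ) ≤ γ / 2 * (n : ℝ) ^ K := by positivity
    rw [pow_succ]
    refine (mul_le_mul_of_nonneg_right hind hD).trans ?_
    refine card_mul_le_card_of_fibres
      (t := fun f => (connectors H G K r y).filter fun X =>
        Disjoint X (F ∪ Finset.univ.biUnion f))
      (fun f X => (Fin.cons X f : Fin (k + 1) → Finset (Fin n))) ?_ ?_ ?_
    · intro f f' X X' hff
      exact (Fin.cons_injective2 hff).symm
    · intro f hf X hX
      rw [Finset.mem_filter] at hf hX ⊢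
      obtain ⟨-, hfK, hfF, hfR, hfY⟩ := hf
      obtain ⟨hX, hXF⟩ := hX
      obtain ⟨hrX, hyX, hXK, hXr, hXy⟩ := mem_connectors.1 hX
      rw [Finset.disjoint_union_right] at hXF
      rw [biUnion_univ_cons]
      have key : ∀ (B : Finset (Fin n)) (b : Fin n), b ∈ B → B ⊆ F →
          HasPerfectTilingOn H G (insert b X) →
          HasPerfectTilingOn H G (Finset.univ.biUnion f ∪ B.erase b) →
          HasPerfectTilingOn H G (X ∪ Finset.univ.biUnion f ∪ B) := by
        intro B b hb hBF hbX hfB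
        have heq : X ∪ Finset.univ.biUnion f ∪ B =
            insert b X ∪ (Finset.univ.biUnion f ∪ B.erase b) := by
          ext v
          by_cases hvb : v = b
          · subst hvb; simp [hb]
          · simp [hvb]
        rw [heq]
        refine hbX.union hfB ?_
        rw [Finset.disjoint_insert_left, Finset.disjoint_union_right, Finset.mem_union, not_or]
        exact ⟨⟨fun hbf => Finset.disjoint_left.1 hfF hbf (hBF hb), Finset.notMem_erase _ _⟩,
          hXF.2, hXF.1.mono_right ((Finset.erase_subset _ _).trans hBF)⟩
      refine ⟨Finset.mem_univ _, ?_, ?_, key R r hr hRF hXr hfR, key Y y hy hYF hXy hfY⟩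
      · exact Fin.cases hXK hfK
      · exact Finset.disjoint_union_left.2 ⟨hXF.1, hfF⟩
    · intro f hf
      refine card_filter_disjoint_ge (fun X hX => (mem_connectors.1 hX).2.2.1) hγ (hconn r y) ?_
      rw [Finset.mem_filter] at hf
      have hU : (Finset.univ.biUnion f).card ≤ k * K := by
        refine Finset.card_biUnion_le.trans ?_
        rw [Finset.sum_congr rfl fun i _ => hf.2.1 i]
        simp
      have hFU : ((F ∪ Finset.univ.biUnion f).card : ℝ) ≤ F.card + k * K := by
        exact_mod_cast (Finset.card_union_le _ _).trans (Nat.add_le_add_left hU _)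
      linarith

open Classical in
/-- Many `(h - 1)`-sets extend a given vertex to a copy of `H`. -/
lemma card_copies_through_ge {s : ℕ} (hs : 0 < s) (hh : 0 < h) {γ : ℝ} (x : Fin n)
    (hconn : γ * (n : ℝ) ^ (s * h - 1) ≤ (connectors H G (s * h - 1) x x).card) :
    γ * (n : ℝ) ^ (h - 1) ≤ ((Finset.univ : Finset (Finset (Fin n))).filter fun Y =>
      x ∉ Y ∧ IsCopySet H G (insert x Y)).card := by
  set 𝒴 := (Finset.univ : Finset (Finset (Fin n))).filter fun Y =>
    x ∉ Y ∧ IsCopySet H G (insert x Y) with h𝒴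
  obtain ⟨s, rfl⟩ : ∃ t, s = t + 1 := ⟨s - 1, by omega⟩
  have hexp : (s + 1) * h - 1 = (h - 1) + s * h := by
    rw [Nat.succ_mul]; omega
  have hsub : connectors H G ((s + 1) * h - 1) x x ⊆
      (𝒴 ×ˢ Finset.powersetCard (s * h) Finset.univ).image fun p => p.1 ∪ p.2 := by
    intro X hX
    obtain ⟨hxX, -, hXc, ⟨𝒯, hcopy, -, hcover⟩, -⟩ := mem_connectors.1 hX
    have hx : x ∈ 𝒯.biUnion id := hcover ▸ Finset.mem_insert_self x X
    obtain ⟨T, hT, hxT⟩ := Finset.mem_biUnion.1 hx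
    rw [id] at hxT
    have hTX : T.erase x ⊆ X := by
      rw [← Finset.subset_insert_iff, ← hcover]
      exact Finset.subset_biUnion_of_mem id hT
    refine Finset.mem_image.2 ⟨(T.erase x, X \ T.erase x), ?_,
      Finset.union_sdiff_of_subset hTX⟩
    rw [Finset.mem_product, Finset.mem_powersetCard_univ, Finset.card_sdiff_of_subset hTX,
      Finset.card_erase_of_mem hxT, (hcopy T hT).card_eq, hXc, h𝒴, Finset.mem_filter]
    refine ⟨⟨Finset.mem_univ _, Finset.notMem_erase _ _, ?_⟩, by omega⟩
    rw [Finset.insert_erase hxT]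
    exact hcopy T hT
  have hle := (Finset.card_le_card hsub).trans Finset.card_image_le
  rw [Finset.card_product] at hle
  have hn : (0 : ℝ) < (n : ℝ) ^ (s * h) := by
    have : (0 : ℝ) < n := by exact_mod_cast x.pos
    positivity
  refine le_of_mul_le_mul_right ?_ hn
  calc γ * (n : ℝ) ^ (h - 1) * (n : ℝ) ^ (s * h) = γ * (n : ℝ) ^ ((s + 1) * h - 1) := by
        rw [hexp, pow_add, mul_assoc]
    _ ≤ (connectors H G ((s + 1) * h - 1) x x).card := hconn
    _ ≤ 𝒴.card * (Finset.powersetCard (s * h) (Finset.univ : Finset (Fin n))).card := by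
        exact_mod_cast hle
    _ ≤ 𝒴.card * (n : ℝ) ^ (s * h) := by
        gcongr
        exact card_powersetCard_univ_le n _

/-- The candidates for absorbers: an `(h - 1)`-set together with `h - 1` sets of size `K`. -/
def candidates (h n K : ℕ) : Finset (Finset (Fin n) × (Fin (h - 1) → Finset (Fin n))) :=
  Finset.powersetCard (h - 1) Finset.univ ×ˢ
    Fintype.piFinset fun _ => Finset.powersetCard K Finset.univ

/-- The vertex set of a candidate. -/
def candidateSupport (ω : Finset (Fin n) × (Fin (h - 1) → Finset (Fin n))) : Finset (Fin n) :=
  ω.1 ∪ Finset.univ.biUnion ω.2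

lemma card_candidates_le (h n K : ℕ) :
    ((candidates h n K).card : ℝ) ≤ (n : ℝ) ^ (h - 1) * ((n : ℝ) ^ K) ^ (h - 1) := by
  rw [candidates, Finset.card_product, Fintype.card_piFinset, Finset.prod_const, Finset.card_univ,
    Fintype.card_fin, Nat.cast_mul, Nat.cast_pow]
  gcongr <;> exact card_powersetCard_univ_le _ _

lemma card_candidateSupport_le {K : ℕ} {ω : Finset (Fin n) × (Fin (h - 1) → Finset (Fin n))}
    (hω : ω ∈ candidates h n K) : (candidateSupport ω).card ≤ (h - 1) * (K + 1) := by
  simp only [candidates, Finset.mem_product, Finset.mem_powersetCard_univ,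
    Fintype.mem_piFinset] at hω
  refine (Finset.card_union_le _ _).trans ?_
  have hU : (Finset.univ.biUnion ω.2).card ≤ (h - 1) * K := by
    refine Finset.card_biUnion_le.trans ?_
    rw [Finset.sum_congr rfl fun i _ => hω.2 i]
    simp
  rw [hω.1, Nat.mul_succ]
  omega

lemma candidateSupport_nonempty {K : ℕ} (hh : 2 ≤ h)
    {ω : Finset (Fin n) × (Fin (h - 1) → Finset (Fin n))} (hω : ω ∈ candidates h n K) :
    (candidateSupport ω).Nonempty := by
  simp only [candidates, Finset.mem_product, Finset.mem_powersetCard_univ] at hω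
  have : ω.1.Nonempty := Finset.card_pos.1 (by omega)
  exact this.mono Finset.subset_union_left

open Classical in
lemma card_absorbing_candidates_ge {s : ℕ} (hs : 0 < s) (hh : 0 < h) {γ : ℝ} (hγ : 0 ≤ γ)
    (hconn : ∀ x y, γ * (n : ℝ) ^ (s * h - 1) ≤ (connectors H G (s * h - 1) x y).card)
    {Q F : Finset (Fin n)} (hQ : Q.card = h)
    (hF : (F.card : ℝ) + h + s * h ^ 2 ≤ γ / 2 * n) :
    (γ / 2) ^ h * ((n : ℝ) ^ (h - 1) * ((n : ℝ) ^ (s * h - 1)) ^ (h - 1)) ≤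
      ((candidates h n (s * h - 1)).filter fun ω => Disjoint (candidateSupport ω) F ∧
        IsAbsorbingFor H G (candidateSupport ω) Q).card := by
  set K := s * h - 1 with hK
  have hKs : K + 1 = s * h := by have := Nat.mul_pos hs hh; omega
  obtain ⟨x, hx⟩ := Finset.card_pos.1 (hQ ▸ hh)
  have hsize : (h - 1) + (h - 1) * K ≤ s * h ^ 2 := by
    calc (h - 1) + (h - 1) * K = (h - 1) * (K + 1) := by ring
      _ ≤ h * (s * h) := by rw [hKs]; gcongr; omega
      _ = s * h ^ 2 := by ring
  have hsize' : ((h - 1 : ℕ) : ℝ) + (h - 1 : ℕ) * (K : ℝ) ≤ s * (h : ℝ) ^ 2 := by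
    exact_mod_cast hsize
  have hFQ : ((F ∪ Q).card : ℝ) ≤ F.card + h := by
    exact_mod_cast hQ ▸ Finset.card_union_le F Q
  have hnn : (0 : ℝ) ≤ (h - 1 : ℕ) * (K : ℝ) := by positivity
  have hnn' : (0 : ℝ) ≤ ((h - 1 : ℕ) : ℝ) := by positivity
  have h𝒴card : ∀ Y ∈ (Finset.univ : Finset (Finset (Fin n))).filter
      (fun Y => x ∉ Y ∧ IsCopySet H G (insert x Y)), Y.card = h - 1 := by
    intro Y hY
    rw [Finset.mem_filter] at hY
    have := hY.2.2.card_eq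
    rw [Finset.card_insert_of_notMem hY.2.1] at this
    omega
  have hYs := card_filter_disjoint_ge h𝒴card hγ (card_copies_through_ge hs hh x (hconn x x))
    (F := F ∪ Q) (by linarith)
  have hD : (0 : ℝ) ≤ (γ / 2 * (n : ℝ) ^ K) ^ (h - 1) := by positivity
  calc (γ / 2) ^ h * ((n : ℝ) ^ (h - 1) * ((n : ℝ) ^ K) ^ (h - 1))
      = (γ / 2 * (n : ℝ) ^ (h - 1)) * (γ / 2 * (n : ℝ) ^ K) ^ (h - 1) := by
        rw [mul_pow]
        nth_rewrite 1 [← Nat.sub_add_cancel hh]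
        ring
    _ ≤ _ := mul_le_mul_of_nonneg_right hYs hD
    _ ≤ _ := by
      refine card_mul_le_card_of_fibres
        (t := fun Y => (Finset.univ : Finset (Fin (h - 1) → Finset (Fin n))).filter fun f =>
          (∀ i, (f i).card = K) ∧ Disjoint (Finset.univ.biUnion f) (F ∪ Q ∪ Y) ∧
          HasPerfectTilingOn H G (Finset.univ.biUnion f ∪ Q.erase x) ∧
          HasPerfectTilingOn H G (Finset.univ.biUnion f ∪ Y))
        (fun Y f => (Y, f)) ?_ ?_ ?_
      · intro Y Y' f f' hYf
        exact Prod.mk.inj hYf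
      · intro Y hY f hf
        have hYc := h𝒴card Y (Finset.mem_filter.1 hY).1
        simp only [Finset.mem_filter, Finset.mem_univ, true_and] at hY hf
        obtain ⟨⟨hxY, hcopy⟩, hYFQ⟩ := hY
        obtain ⟨hfK, hfd, hfQ, hfY⟩ := hf
        rw [Finset.disjoint_union_right] at hYFQ
        rw [Finset.disjoint_union_right, Finset.disjoint_union_right] at hfd
        rw [Finset.mem_filter]
        refine ⟨?_, ?_, ?_, ?_⟩
        · simp only [candidates, Finset.mem_product, Finset.mem_powersetCard_univ,
            Fintype.mem_piFinset]
          exact ⟨hYc, hfK⟩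
        · exact Finset.disjoint_union_left.2 ⟨hYFQ.1, hfd.1.1⟩
        · rw [candidateSupport, Finset.union_comm]
          exact hfY
        · have heq : candidateSupport (h := h) (Y, f) ∪ Q =
              insert x Y ∪ (Finset.univ.biUnion f ∪ Q.erase x) := by
            ext v
            by_cases hv : v = x
            · subst hv; simp [hx]
            · simp [candidateSupport, hv]
          rw [heq]
          refine hcopy.hasPerfectTilingOn.union hfQ ?_
          rw [Finset.disjoint_insert_left, Finset.disjoint_union_right, Finset.mem_union, not_or]
          exact ⟨⟨fun hxf => Finset.disjoint_left.1 hfd.1.2 hxf hx, Finset.notMem_erase _ _⟩,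
            hfd.2.symm, hYFQ.2.mono_right (Finset.erase_subset _ _)⟩
      · intro Y hY
        have hYc := h𝒴card Y (Finset.mem_filter.1 hY).1
        refine card_switching_tuples_ge hγ hconn (F ∪ Q ∪ Y) (h - 1) (Q.erase x) Y
          (by rw [Finset.card_erase_of_mem hx, hQ]) hYc ?_ Finset.subset_union_right ?_
        · exact (Finset.erase_subset _ _).trans
            (Finset.subset_union_right.trans Finset.subset_union_left)
        · have hFQY : ((F ∪ Q ∪ Y).card : ℝ) ≤ (F ∪ Q).card + (h - 1 : ℕ) := by
            exact_mod_cast hYc ▸ Finset.card_union_le (F ∪ Q) Y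
          linarith

end Absorbers

section Greedy

open Classical in
/-- A greedy selection of disjoint sets, keeping an exponential potential small. -/
lemma exists_disjoint_family {ι β V : Type*} [DecidableEq V] {Ω : Finset ι} {st : ι → Finset V}
    {𝒬 : Finset β} (h𝒬 : 𝒬.Nonempty) {good : Finset V → β → Prop} {N c : ℝ} {m K : ℕ}
    (hN : 0 < N) (hΩ : (Ω.card : ℝ) ≤ N) (hc : 0 < c) (hc' : c ≤ 2)
    (hne : ∀ ω ∈ Ω, (st ω).Nonempty) (hst : ∀ ω ∈ Ω, (st ω).card ≤ m)
    (hcount : ∀ F : Finset V, F.card ≤ K → ∀ Q ∈ 𝒬,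
      c * N ≤ (Ω.filter fun ω => Disjoint (st ω) F ∧ good (st ω) Q).card) (T : ℕ) :
    T * m ≤ K → ∃ 𝓕 : Finset (Finset V), (𝓕 : Set (Finset V)).PairwiseDisjoint id ∧
      (𝓕.biUnion id).card ≤ T * m ∧ (∀ S ∈ 𝓕, ∃ Q ∈ 𝒬, good S Q) ∧
      ∑ Q ∈ 𝒬, (1 / 2 : ℝ) ^ (𝓕.filter fun S => good S Q).card ≤ 𝒬.card * (1 - c / 2) ^ T := by
  induction T with
  | zero => exact fun _ => ⟨∅, by simp⟩
  | succ T ih =>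
    intro hT
    rw [Nat.succ_mul] at hT
    obtain ⟨𝓕, hdisj, hcard, hgood, hpot⟩ := ih (by omega)
    set M := 𝓕.biUnion id with hM
    set w : β → ℝ := fun Q => (1 / 2 : ℝ) ^ (𝓕.filter fun S => good S Q).card with hw
    have hw0 : ∀ Q, 0 ≤ w Q := fun Q => by positivity
    set B := Ω.filter fun ω => Disjoint (st ω) M ∧ ∃ Q ∈ 𝒬, good (st ω) Q with hB
    have hBQ : ∀ Q ∈ 𝒬, c * N ≤ (B.filter fun ω => good (st ω) Q).card := by
      intro Q hQ
      refine (hcount M (by omega) Q hQ).trans ?_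
      have : (Ω.filter fun ω => Disjoint (st ω) M ∧ good (st ω) Q) ⊆
          B.filter fun ω => good (st ω) Q := by
        intro ω hω
        simp only [hB, Finset.mem_filter] at hω ⊢
        exact ⟨⟨hω.1, hω.2.1, Q, hQ, hω.2.2⟩, hω.2.2⟩
      exact_mod_cast Finset.card_le_card this
    have hBN : (B.card : ℝ) ≤ N :=
      le_trans (by exact_mod_cast Finset.card_le_card (Finset.filter_subset _ _)) hΩ
    have hBne : B.Nonempty := by
      obtain ⟨Q, hQ⟩ := h𝒬
      have hpos : (0 : ℝ) < (B.filter fun ω => good (st ω) Q).card :=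
        (mul_pos hc hN).trans_le (hBQ Q hQ)
      have hpos' : 0 < (B.filter fun ω => good (st ω) Q).card := by exact_mod_cast hpos
      exact (Finset.card_pos.1 hpos').mono (Finset.filter_subset _ _)
    obtain ⟨ω, hω, hωle⟩ := Finset.exists_le_of_sum_le hBne
      (f := fun ω => ∑ Q ∈ 𝒬, w Q * (1 - if good (st ω) Q then 1 / 2 else 0))
      (g := fun _ => (1 - c / 2) * ∑ Q ∈ 𝒬, w Q) (by
        rw [Finset.sum_comm, Finset.sum_const, nsmul_eq_mul, Finset.mul_sum, Finset.mul_sum]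
        refine Finset.sum_le_sum fun Q hQ => ?_
        rw [← Finset.mul_sum, Finset.sum_sub_distrib, Finset.sum_const, nsmul_eq_mul, mul_one,
          ← Finset.sum_filter, Finset.sum_const, nsmul_eq_mul]
        have h1 := hBQ Q hQ
        have h2 : c * B.card ≤ c * N := mul_le_mul_of_nonneg_left hBN hc.le
        have h3 : (B.card : ℝ) - (B.filter fun ω => good (st ω) Q).card * (1 / 2) ≤
          B.card * (1 - c / 2) := by linarith
        calc _ ≤ w Q * (B.card * (1 - c / 2)) := mul_le_mul_of_nonneg_left h3 (hw0 Q)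
          _ = _ := by ring)
    have hωB := Finset.mem_filter.1 hω
    have hnot : st ω ∉ 𝓕 := by
      intro hmem
      have hsub : st ω ⊆ M := Finset.subset_biUnion_of_mem id hmem
      exact (hne ω hωB.1).ne_empty (disjoint_self.1 (hωB.2.1.mono_right hsub))
    refine ⟨insert (st ω) 𝓕, ?_, ?_, ?_, ?_⟩
    · rw [Finset.coe_insert, Set.pairwiseDisjoint_insert]
      exact ⟨hdisj, fun S hS _ => hωB.2.1.mono_right (Finset.subset_biUnion_of_mem id hS)⟩
    · rw [Finset.biUnion_insert, Nat.succ_mul, ← hM]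
      have h1 := Finset.card_union_le (id (st ω)) M
      have h2 := hst ω hωB.1
      simp only [id] at h1 ⊢
      omega
    · intro S hS
      rcases Finset.mem_insert.1 hS with rfl | hS
      exacts [hωB.2.2, hgood S hS]
    · calc ∑ Q ∈ 𝒬, (1 / 2 : ℝ) ^ ((insert (st ω) 𝓕).filter fun S => good S Q).card
          = ∑ Q ∈ 𝒬, w Q * (1 - if good (st ω) Q then 1 / 2 else 0) := by
            refine Finset.sum_congr rfl fun Q _ => ?_
            rw [Finset.filter_insert]
            split_ifs with hg
            · rw [Finset.card_insert_of_notMem (fun hmem => hnot (Finset.mem_filter.1 hmem).1),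
                pow_succ]
              norm_num [hw]
            · simp [hw]
        _ ≤ (1 - c / 2) * ∑ Q ∈ 𝒬, w Q := hωle
        _ ≤ (1 - c / 2) * (𝒬.card * (1 - c / 2) ^ T) :=
            mul_le_mul_of_nonneg_left hpot (by linarith)
        _ = 𝒬.card * (1 - c / 2) ^ (T + 1) := by ring

end Greedy

section Main

lemma HasPerfectTilingOn.of_one {n : ℕ} (H : SimpleGraph (Fin 1)) (G : SimpleGraph (Fin n))
    (W : Finset (Fin n)) : HasPerfectTilingOn H G W := by
  induction W using Finset.induction_on with
  | empty => exact HasPerfectTilingOn.empty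
  | insert v W hv ih =>
    have hcopy : IsCopySet H G {v} := by
      refine ⟨fun _ => v, ⟨Subsingleton.strictMono _, fun i j hij => ?_⟩, by simp⟩
      exact absurd (Subsingleton.elim i j) hij.ne
    rw [Finset.insert_eq]
    exact hcopy.hasPerfectTilingOn.union ih (Finset.disjoint_singleton_left.2 hv)

lemma ncard_eq_card_connectors {h n : ℕ} (H : SimpleGraph (Fin h)) (G : SimpleGraph (Fin n))
    (k : ℕ) (x y : Fin n) :
    {X : Finset (Fin n) | x ∉ X ∧ y ∉ X ∧ X.card = k ∧
      HasPerfectTilingOn H G (insert x X) ∧ HasPerfectTilingOn H G (insert y X)}.ncard =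
      (connectors H G k x y).card := by
  rw [← Set.ncard_coe_finset]
  congr 1
  ext X
  simp [mem_connectors]

lemma le_one_of_mul_pow_le_card_connectors {h n k : ℕ} {H : SimpleGraph (Fin h)}
    {G : SimpleGraph (Fin n)} {γ : ℝ} {x : Fin n}
    (hconn : γ * (n : ℝ) ^ k ≤ (connectors H G k x x).card) : γ ≤ 1 := by
  have hn : (0 : ℝ) < (n : ℝ) ^ k := by
    have : (0 : ℝ) < n := by exact_mod_cast x.pos
    positivity
  refine le_of_mul_le_mul_right ?_ hn
  rw [one_mul]
  refine hconn.trans (le_trans ?_ (card_powersetCard_univ_le n k))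
  have hsub : connectors H G k x x ⊆ Finset.powersetCard k Finset.univ := fun X hX =>
    Finset.mem_powersetCard_univ.2 (mem_connectors.1 hX).2.2.1
  exact_mod_cast Finset.card_le_card hsub

lemma eventually_log_small (a b d : ℝ) {ε : ℝ} (hε : 0 < ε) :
    ∀ᶠ n : ℕ in Filter.atTop, a ≤ (n : ℝ) ∧ d * Real.log n + b < ε * n := by
  have hlog : ∀ᶠ n : ℕ in Filter.atTop,
      ‖d * Real.log (n : ℝ)‖ ≤ ε / 2 * ‖(n : ℝ)‖ :=
    tendsto_natCast_atTop_atTop.eventually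
      ((Real.isLittleO_log_id_atTop.const_mul_left d).bound (half_pos hε))
  filter_upwards [hlog, tendsto_natCast_atTop_atTop.eventually_ge_atTop a,
    tendsto_natCast_atTop_atTop.eventually_gt_atTop (2 * b / ε)] with n h1 h2 h3
  refine ⟨h2, ?_⟩
  rw [div_lt_iff₀ hε] at h3
  rw [Real.norm_natCast] at h1
  linarith [le_of_abs_le h1]

/-- A small potential forces many absorbers. -/
lemma le_of_potential_le {r t T n h : ℕ} {c A : ℝ} (hn : 0 < n) (hA : A ≤ (n : ℝ) ^ h)
    (hc : c ≤ 2) (hpot : (1 / 2 : ℝ) ^ r ≤ A * (1 - c / 2) ^ T)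
    (hT : t + h * Real.log n < c / 2 * T) : t ≤ r := by
  by_contra! hlt
  have hn' : (0 : ℝ) < n := by exact_mod_cast hn
  have h1 : (1 - c / 2) ^ T ≤ Real.exp (-(c / 2 * T)) := by
    calc (1 - c / 2) ^ T ≤ Real.exp (-(c / 2)) ^ T :=
          pow_le_pow_left₀ (by linarith) (by linarith [Real.add_one_le_exp (-(c / 2))]) T
      _ = Real.exp (-(c / 2 * T)) := by rw [← Real.exp_nat_mul]; ring_nf
  have h2 : Real.exp (-t) ≤ (1 / 2 : ℝ) ^ r := by
    calc Real.exp (-t) = Real.exp (-1) ^ t := by rw [← Real.exp_nat_mul]; ring_nf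
      _ ≤ (1 / 2) ^ t := by
          refine pow_le_pow_left₀ (Real.exp_nonneg _) ?_ t
          rw [Real.exp_neg, one_div]
          exact inv_anti₀ two_pos (by linarith [Real.add_one_le_exp (1 : ℝ)])
      _ ≤ (1 / 2) ^ r := pow_le_pow_of_le_one (by norm_num) (by norm_num) hlt.le
  have h3 : (n : ℝ) ^ h = Real.exp (h * Real.log n) := by
    rw [Real.exp_nat_mul, Real.exp_log hn']
  have h4 : Real.exp (-t) ≤ Real.exp (h * Real.log n + -(c / 2 * T)) := by
    rw [Real.exp_add, ← h3]
    refine (h2.trans hpot).trans (mul_le_mul hA h1 (pow_nonneg (by linarith) T) (by positivity))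
  linarith [Real.exp_le_exp.1 h4]

end Main

theorem absorbing_set_from_connectivity (h s : ℕ) (γ : ℝ) (hγ : 0 < γ)
    (H : SimpleGraph (Fin h)) :
    ∃ n₀ : ℕ, ∀ n : ℕ, n₀ ≤ n → ∀ G : SimpleGraph (Fin n),
      (∀ x y : Fin n,
        γ * (n : ℝ) ^ (s * h - 1) ≤
          ({X : Finset (Fin n) | x ∉ X ∧ y ∉ X ∧ X.card = s * h - 1 ∧
            HasPerfectTilingOn H G (insert x X) ∧
            HasPerfectTilingOn H G (insert y X)}.ncard : ℝ)) →
      ∃ M : Finset (Fin n), (M.card : ℝ) ≤ (γ / 2) ^ h * n / 4 ∧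
        ∀ W : Finset (Fin n), Disjoint W M → h ∣ W.card →
          (W.card : ℝ) ≤ (γ / 2) ^ (2 * h) * n / (32 * s ^ 2 * h ^ 3) →
          IsAbsorbingFor H G M W := by
  classical
  by_cases hdeg : s = 0 ∨ h = 0
  · refine ⟨0, fun n _ G _ => ⟨∅, by simp; positivity, fun W _ _ hW => ?_⟩⟩
    have hden : (32 * s ^ 2 * h ^ 3 : ℝ) = 0 := by
      rcases hdeg with rfl | rfl <;> simp
    rw [hden, div_zero] at hW
    have hW0 : W = ∅ := Finset.card_eq_zero.1 (by exact_mod_cast le_antisymm hW (Nat.cast_nonneg _))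
    subst hW0
    exact ⟨HasPerfectTilingOn.empty, by simpa using HasPerfectTilingOn.empty⟩
  obtain ⟨hs, hh⟩ : 0 < s ∧ 0 < h := by omega
  by_cases hone : h = 1
  · subst hone
    exact ⟨0, fun n _ G _ => ⟨∅, by simp; positivity, fun W _ _ _ =>
      ⟨HasPerfectTilingOn.of_one _ _ _, HasPerfectTilingOn.of_one _ _ _⟩⟩⟩
  have hh2 : 2 ≤ h := by omega
  set c : ℝ := (γ / 2) ^ h with hc
  have hc0 : 0 < c := by positivity
  have hs1 : (1 : ℝ) ≤ s := by exact_mod_cast hs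
  have hh1 : (1 : ℝ) ≤ h := by exact_mod_cast hh
  set D : ℝ := s * (h : ℝ) ^ 2 with hD
  have hD0 : 0 < D := by positivity
  obtain ⟨n₀, hn₀⟩ := Filter.eventually_atTop.1
    (eventually_log_small (h + 4 * (h + D) / γ) (c / 2) h (ε := 3 * c ^ 2 / (32 * D))
      (by positivity))
  refine ⟨n₀, fun n hn G hG => ?_⟩
  obtain ⟨hnlarge, hnlog⟩ := hn₀ n hn
  have hfrac : 0 < 4 * (h + D) / γ := by positivity
  have hnh : h ≤ n := by exact_mod_cast (show (h : ℝ) ≤ n by linarith)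
  have hnD : h + D ≤ γ / 4 * n := by
    have : 4 * (h + D) / γ ≤ n := by linarith
    rw [div_le_iff₀ hγ] at this
    linarith
  have hn0 : 0 < n := by omega
  have hn0' : (0 : ℝ) < n := by exact_mod_cast hn0
  have hconn : ∀ x y, γ * (n : ℝ) ^ (s * h - 1) ≤ (connectors H G (s * h - 1) x y).card := by
    intro x y
    rw [← ncard_eq_card_connectors]
    exact hG x y
  have hγ1 : γ ≤ 1 := le_one_of_mul_pow_le_card_connectors (hconn ⟨0, hn0⟩ ⟨0, hn0⟩)
  have hcγ : c ≤ γ / 2 := pow_le_of_le_one (by linarith) (by linarith) (by omega)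
  set T := ⌊c * n / (4 * D)⌋₊ with hT
  have hTle : (T : ℝ) * D ≤ c * n / 4 := by
    have := Nat.floor_le (show 0 ≤ c * n / (4 * D) by positivity)
    rw [← hT, le_div_iff₀ (by positivity)] at this
    linarith
  have hTge : c * n / (4 * D) < T + 1 := Nat.lt_floor_add_one _
  have hDcast : ((s * h ^ 2 : ℕ) : ℝ) = D := by push_cast; rfl
  obtain ⟨𝓕, hdisj, hcard, hgood, hpot⟩ := exists_disjoint_family
    (Ω := candidates h n (s * h - 1)) (st := candidateSupport)
    (𝒬 := Finset.powersetCard h (Finset.univ : Finset (Fin n)))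
    (good := fun S Q => IsAbsorbingFor H G S Q) (c := c) (m := s * h ^ 2) (K := T * (s * h ^ 2))
    (Finset.powersetCard_nonempty.2 (by simpa using hnh)) (by positivity)
    (card_candidates_le h n (s * h - 1)) hc0 (by linarith)
    (fun ω hω => candidateSupport_nonempty hh2 hω)
    (fun ω hω => (card_candidateSupport_le hω).trans (by
      have hpos := Nat.mul_pos hs hh
      calc (h - 1) * (s * h - 1 + 1) ≤ h * (s * h) := by
            rw [Nat.sub_add_cancel hpos]
            exact Nat.mul_le_mul_right _ (Nat.sub_le h 1)
        _ = s * h ^ 2 := by ring))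
    (fun F hF Q hQ => by
      refine card_absorbing_candidates_ge hs hh hγ.le hconn
        (Finset.mem_powersetCard_univ.1 hQ) ?_
      have hF' : (F.card : ℝ) ≤ T * D := by
        rw [← hDcast]
        exact_mod_cast hF
      have hcn : c * n ≤ γ / 2 * n := mul_le_mul_of_nonneg_right hcγ hn0'.le
      linarith [mul_pos hγ hn0']) T le_rfl
  refine ⟨𝓕.biUnion id, ?_, fun W hWd hWh hW => ?_⟩
  · refine le_trans ?_ hTle
    rw [← hDcast]
    exact_mod_cast hcard
  have htiled : ∀ S ∈ 𝓕, HasPerfectTilingOn H G S := fun S hS => by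
    obtain ⟨Q, -, hQ⟩ := hgood S hS
    exact hQ.1
  obtain ⟨t, ht⟩ := hWh
  refine ⟨HasPerfectTilingOn.biUnion hdisj htiled,
    HasPerfectTilingOn.biUnion_union_of_absorbers t 𝓕 W hdisj htiled (fun Q hQ => ?_)
      hWd.symm (by rw [ht, mul_comm])⟩
  refine ⟨𝓕.filter fun S => IsAbsorbingFor H G S Q, Finset.filter_subset _ _, ?_,
    fun S hS => (Finset.mem_filter.1 hS).2.2⟩
  have hsingle := (Finset.single_le_sum
    (f := fun Q => (1 / 2 : ℝ) ^ (𝓕.filter fun S => IsAbsorbingFor H G S Q).card)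
    (fun _ _ => by positivity) (Finset.mem_powersetCard_univ.2 hQ)).trans hpot
  refine le_of_potential_le hn0 (card_powersetCard_univ_le n h) (by linarith) hsingle ?_
  have htD : (t : ℝ) ≤ c ^ 2 * n / (32 * D) := by
    rw [ht, mul_comm 2 h, pow_mul, ← hc, le_div_iff₀ (by positivity)] at hW
    push_cast at hW
    rw [le_div_iff₀ (by positivity)]
    refine le_trans ?_ hW
    have hle : D ≤ s ^ 2 * (h : ℝ) ^ 4 := by
      rw [hD]
      exact mul_le_mul (le_self_pow₀ hs1 two_ne_zero) (pow_le_pow_right₀ hh1 (by norm_num))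
        (by positivity) (by positivity)
    calc (t : ℝ) * (32 * D) ≤ t * (32 * (s ^ 2 * (h : ℝ) ^ 4)) := by gcongr
      _ = h * t * (32 * s ^ 2 * h ^ 3) := by ring
  have hcT : c / 2 * (c * n / (4 * D)) ≤ c / 2 * (T + 1) :=
    mul_le_mul_of_nonneg_left hTge.le (by positivity)
  have hsplit : c / 2 * (c * n / (4 * D)) =
      c ^ 2 * n / (32 * D) + 3 * c ^ 2 / (32 * D) * n := by
    field_simp
    ring
  linarith
end

section
/- For all reals d₁,d₂ with 0<d₂<d₁≤1 there exists ε₀>0 such that for every ε with 0<ε≤ε₀ there exists K∈ℕ with the following property: if G is a graph and A,B are disjoint vertex sets with |A|,|B| ≥ K such that the pair (A,B) is ε-regular in G with density d(A,B)=d₁, then there exists a spanning subgraph G' of G such that the pair (A,B) is √ε-regular in G' and its density d in G' satisfies |d − d₂| ≤ ε. -/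
open Finset

/-- The moment generating function of a binomial variable, for random subsets of `E` that contain
each element independently with probability `p`. -/
lemma sum_powerset_weight_mul_exp {α : Type*} [DecidableEq α] {E F : Finset α} (hF : F ⊆ E)
    (p l : ℝ) :
    ∑ s ∈ E.powerset, p ^ #s * (1 - p) ^ #(E \ s) * Real.exp (l * #(s ∩ F)) =
      (p * Real.exp l + (1 - p)) ^ #F := by
  have h := Finset.prod_add (fun e => p * if e ∈ F then Real.exp l else 1) (fun _ => 1 - p) E
  have hterm : ∀ s ∈ E.powerset, p ^ #s * (1 - p) ^ #(E \ s) * Real.exp (l * #(s ∩ F)) =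
      (∏ e ∈ s, (p * if e ∈ F then Real.exp l else 1)) * ∏ _e ∈ E \ s, (1 - p) := by
    intro s _
    rw [Finset.prod_mul_distrib, Finset.prod_const, Finset.prod_const, Finset.prod_ite_mem,
      Finset.prod_const, mul_comm l, Real.exp_nat_mul]
    ring
  rw [Finset.sum_congr rfl hterm, ← h, ← Finset.prod_subset hF, Finset.prod_congr rfl
    (g := fun _ => p * Real.exp l + (1 - p)), Finset.prod_const]
  · intro e he
    simp [he]
  · intro e _ he
    simp [he]

lemma bernoulli_mgf_le {p l : ℝ} (hp₀ : 0 ≤ p) (hp₁ : p ≤ 1) (hl : |l| ≤ 1) :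
    p * Real.exp l + (1 - p) ≤ Real.exp (p * l + l ^ 2) := by
  have h₁ := (abs_le.mp (Real.abs_exp_sub_one_sub_id_le hl)).2
  have h₂ := Real.add_one_le_exp (p * l + l ^ 2)
  nlinarith [mul_le_mul_of_nonneg_left h₁ hp₀, sq_nonneg l]

lemma sum_powerset_weight_mul_exp_deviation_le {α : Type*} [DecidableEq α] {E F : Finset α}
    (hF : F ⊆ E) {p l N : ℝ} (hp₀ : 0 ≤ p) (hp₁ : p ≤ 1) (hl : |l| ≤ 1) (hN : (#F : ℝ) ≤ N) :
    ∑ s ∈ E.powerset, p ^ #s * (1 - p) ^ #(E \ s) *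
        Real.exp (l * (#(s ∩ F) - p * #F) - 2 * l ^ 2 * N) ≤
      Real.exp (-(l ^ 2 * N)) := by
  have hterm : ∀ s ∈ E.powerset, p ^ #s * (1 - p) ^ #(E \ s) *
        Real.exp (l * (#(s ∩ F) - p * #F) - 2 * l ^ 2 * N) =
      p ^ #s * (1 - p) ^ #(E \ s) * Real.exp (l * #(s ∩ F)) *
        Real.exp (-(l * p * #F) - 2 * l ^ 2 * N) := by
    intro s _
    rw [mul_assoc _ (Real.exp _), ← Real.exp_add]
    ring_nf
  rw [Finset.sum_congr rfl hterm, ← Finset.sum_mul, sum_powerset_weight_mul_exp hF]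
  have hbase : 0 ≤ p * Real.exp l + (1 - p) := by
    have := mul_nonneg hp₀ (Real.exp_pos l).le
    linarith
  calc (p * Real.exp l + (1 - p)) ^ #F * Real.exp (-(l * p * #F) - 2 * l ^ 2 * N)
      ≤ Real.exp (p * l + l ^ 2) ^ #F * Real.exp (-(l * p * #F) - 2 * l ^ 2 * N) := by
        gcongr
        exact bernoulli_mgf_le hp₀ hp₁ hl
    _ = Real.exp (l ^ 2 * #F - 2 * l ^ 2 * N) := by
        rw [← Real.exp_nat_mul, ← Real.exp_add]
        ring_nf
    _ ≤ Real.exp (-(l ^ 2 * N)) := by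
        gcongr
        nlinarith [mul_le_mul_of_nonneg_left hN (sq_nonneg l)]

/-- A Chernoff bound combined with a union bound: some subset of `E` meets every member of a small
family of subsets of `E` in roughly a `p`-fraction of its elements. -/
lemma exists_subset_card_inter_near {α ι : Type*} [DecidableEq α] (E : Finset α) (I : Finset ι)
    (F : ι → Finset α) (N : ι → ℝ) {p t M : ℝ} (hp₀ : 0 ≤ p) (hp₁ : p ≤ 1) (ht₀ : 0 < t)
    (ht₁ : t ≤ 1) (hF : ∀ i ∈ I, F i ⊆ E) (hFN : ∀ i ∈ I, (#(F i) : ℝ) ≤ N i)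
    (hMN : ∀ i ∈ I, M ≤ N i) (hI : 2 * #I * Real.exp (-((t / 2) ^ 2 * M)) < 1) :
    ∃ S ⊆ E, ∀ i ∈ I, |(#(S ∩ F i) : ℝ) - p * #(F i)| < t * N i := by
  by_contra! hcon
  set w : Finset α → ℝ := fun s => p ^ #s * (1 - p) ^ #(E \ s)
  set f : ℝ → ι → Finset α → ℝ := fun l i s =>
    Real.exp (l * (#(s ∩ F i) - p * #(F i)) - 2 * l ^ 2 * N i)
  have hw₀ : ∀ s, 0 ≤ w s := fun s =>
    mul_nonneg (pow_nonneg hp₀ _) (pow_nonneg (by linarith) _)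
  have hw₁ : ∑ s ∈ E.powerset, w s = 1 := by
    simpa using sum_powerset_weight_mul_exp (Finset.empty_subset E) p 0
  have hbound : ∀ l : ℝ, |l| = t / 2 → ∀ i ∈ I,
      ∑ s ∈ E.powerset, w s * f l i s ≤ Real.exp (-((t / 2) ^ 2 * M)) := by
    intro l hl i hi
    refine (sum_powerset_weight_mul_exp_deviation_le (hF i hi) hp₀ hp₁ (by linarith)
      (hFN i hi)).trans ?_
    rw [← sq_abs l, hl]
    gcongr
    exact hMN i hi
  have hlower : ∀ s ∈ E.powerset, 1 ≤ ∑ i ∈ I, (f (t / 2) i s + f (-(t / 2)) i s) := by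
    intro s hs
    obtain ⟨i, hi, hdev⟩ := hcon s (Finset.mem_powerset.mp hs)
    refine le_trans ?_ (Finset.single_le_sum (f := fun i => f (t / 2) i s + f (-(t / 2)) i s)
      (fun j _ => by positivity) hi)
    have hpos₁ : 0 < f (t / 2) i s := Real.exp_pos _
    have hpos₂ : 0 < f (-(t / 2)) i s := Real.exp_pos _
    rcases le_abs.mp hdev with h | h
    · have : 1 ≤ f (t / 2) i s := Real.one_le_exp (by nlinarith)
      linarith
    · have : 1 ≤ f (-(t / 2)) i s := Real.one_le_exp (by nlinarith)
      linarith
  have habs : |t / 2| = t / 2 := abs_of_pos (by linarith)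
  have : (1 : ℝ) ≤ 2 * #I * Real.exp (-((t / 2) ^ 2 * M)) := by
    calc (1 : ℝ) = ∑ s ∈ E.powerset, w s * 1 := by simp [hw₁]
      _ ≤ ∑ s ∈ E.powerset, w s * ∑ i ∈ I, (f (t / 2) i s + f (-(t / 2)) i s) := by
          exact Finset.sum_le_sum fun s hs => mul_le_mul_of_nonneg_left (hlower s hs) (hw₀ s)
      _ = ∑ i ∈ I, (∑ s ∈ E.powerset, w s * f (t / 2) i s +
            ∑ s ∈ E.powerset, w s * f (-(t / 2)) i s) := by
          simp_rw [Finset.mul_sum, mul_add]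
          rw [Finset.sum_comm]
          simp_rw [Finset.sum_add_distrib]
      _ ≤ ∑ _i ∈ I, (Real.exp (-((t / 2) ^ 2 * M)) + Real.exp (-((t / 2) ^ 2 * M))) :=
          Finset.sum_le_sum fun i hi => add_le_add (hbound _ habs i hi)
            (hbound _ (by rw [abs_neg, habs]) i hi)
      _ = 2 * #I * Real.exp (-((t / 2) ^ 2 * M)) := by
          rw [Finset.sum_const, nsmul_eq_mul]
          ring
  linarith

open Classical in
lemma pairDensity_eq_card_filter_div {V : Type*} (G : SimpleGraph V) (A B : Finset V) :
    pairDensity G A B =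
      (#((A ×ˢ B).filter fun e => G.Adj e.1 e.2) : ℝ) / ((#A : ℝ) * #B) := by
  have h : {e : V × V | e.1 ∈ A ∧ e.2 ∈ B ∧ G.Adj e.1 e.2} =
      ↑((A ×ˢ B).filter fun e => G.Adj e.1 e.2) := by
    ext e
    simp [and_assoc]
  rw [pairDensity, h, Set.ncard_coe_finset]

open Classical in
/-- A random sparsification of a bipartite graph scales the densities of all large pairs of subsets
by a factor close to `p`. -/
lemma exists_subgraph_pairDensity_near {V : Type*} (G : SimpleGraph V) {A B : Finset V}
    (hAB : Disjoint A B) {p t δ : ℝ} (hp₀ : 0 ≤ p) (hp₁ : p ≤ 1) (ht₀ : 0 < t) (ht₁ : t ≤ 1)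
    (hδ : 0 < δ) (hA : 0 < #A) (hB : 0 < #B)
    (hsize : (#A : ℝ) + #B + 1 < (t / 2) ^ 2 * (δ ^ 2 * (#A * #B))) :
    ∃ G' ≤ G, ∀ X ⊆ A, ∀ Y ⊆ B, δ * #A ≤ #X → δ * #B ≤ #Y →
      |pairDensity G' X Y - p * pairDensity G X Y| < t := by
  set E := (A ×ˢ B).filter fun e => G.Adj e.1 e.2 with hE
  set I := (A.powerset ×ˢ B.powerset).filter
    fun q => δ * #A ≤ #q.1 ∧ δ * #B ≤ #q.2 with hI
  set F : Finset V × Finset V → Finset (V × V) :=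
    fun q => (q.1 ×ˢ q.2).filter fun e => G.Adj e.1 e.2 with hF
  have hcard : (#I : ℝ) ≤ Real.exp (#A + #B) := by
    have h₁ : #I ≤ 2 ^ (#A + #B) := by
      refine (Finset.card_filter_le _ _).trans ?_
      rw [Finset.card_product, Finset.card_powerset, Finset.card_powerset, pow_add]
    calc (#I : ℝ) ≤ 2 ^ (#A + #B) := mod_cast h₁
      _ ≤ Real.exp 1 ^ (#A + #B) := by
          gcongr
          linarith [Real.add_one_le_exp 1]
      _ = Real.exp (#A + #B) := by rw [← Real.exp_nat_mul]; simp
  obtain ⟨S, hSE, hS⟩ := exists_subset_card_inter_near E I F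
    (fun q => (#q.1 : ℝ) * #q.2) (p := p) (t := t) (M := δ ^ 2 * (#A * #B)) hp₀ hp₁ ht₀ ht₁
    (by
      intro q hq
      simp only [hI, Finset.mem_filter, Finset.mem_product, Finset.mem_powerset] at hq
      exact Finset.filter_subset_filter _ (Finset.product_subset_product hq.1.1 hq.1.2))
    (by
      intro q _
      rw [← Nat.cast_mul, ← Finset.card_product]
      exact_mod_cast Finset.card_filter_le _ _)
    (by
      intro q hq
      simp only [hI, Finset.mem_filter] at hq
      calc δ ^ 2 * (#A * #B) = (δ * #A) * (δ * #B) := by ring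
        _ ≤ (#q.1 : ℝ) * #q.2 := by
          gcongr
          exacts [hq.2.1, hq.2.2])
    (by
      calc 2 * (#I : ℝ) * Real.exp (-((t / 2) ^ 2 * (δ ^ 2 * (#A * #B))))
          ≤ Real.exp 1 * Real.exp (#A + #B) *
              Real.exp (-((t / 2) ^ 2 * (δ ^ 2 * (#A * #B)))) := by
            gcongr
            linarith [Real.add_one_le_exp 1]
        _ < 1 := by
            rw [← Real.exp_add, ← Real.exp_add, Real.exp_lt_one_iff]
            linarith)
  obtain ⟨G', hG'⟩ : ∃ G' : SimpleGraph V,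
      ∀ u v, G'.Adj u v ↔ G.Adj u v ∧ ((u, v) ∈ S ∨ (v, u) ∈ S) :=
    ⟨{ Adj := fun u v => G.Adj u v ∧ ((u, v) ∈ S ∨ (v, u) ∈ S)
       symm := ⟨fun u v h => ⟨h.1.symm, h.2.symm⟩⟩
       loopless := ⟨fun u h => G.irrefl h.1⟩ }, fun _ _ => Iff.rfl⟩
  refine ⟨G', fun u v h => ((hG' u v).mp h).1, fun X hX Y hY hXA hYB => ?_⟩
  have hXpos : 0 < (#X : ℝ) := lt_of_lt_of_le (by positivity) hXA
  have hYpos : 0 < (#Y : ℝ) := lt_of_lt_of_le (by positivity) hYB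
  have hdev := hS (X, Y) (by simp [hI, hX, hY, hXA, hYB])
  have hedges : ((X ×ˢ Y).filter fun e => G'.Adj e.1 e.2) = S ∩ F (X, Y) := by
    ext ⟨u, v⟩
    simp only [hF, hG', Finset.mem_filter, Finset.mem_product, Finset.mem_inter]
    constructor
    · rintro ⟨⟨hu, hv⟩, hadj, huv | hvu⟩
      · exact ⟨huv, ⟨hu, hv⟩, hadj⟩
      · have hmem := hSE hvu
        simp only [hE, Finset.mem_filter, Finset.mem_product] at hmem
        exact absurd hmem.1.1 (Finset.disjoint_right.mp hAB (hY hv))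
    · rintro ⟨huv, ⟨hu, hv⟩, hadj⟩
      exact ⟨⟨hu, hv⟩, hadj, Or.inl huv⟩
  rw [pairDensity_eq_card_filter_div G', pairDensity_eq_card_filter_div G, hedges, ← mul_div_assoc,
    ← sub_div, abs_div, abs_of_pos (mul_pos hXpos hYpos), div_lt_iff₀ (mul_pos hXpos hYpos)]
  exact hdev

theorem regular_pair_sparsening (d₁ d₂ : ℝ) (hd₂ : 0 < d₂) (hd₁₂ : d₂ < d₁) (hd₁ : d₁ ≤ 1) :
    ∃ ε₀ : ℝ, 0 < ε₀ ∧ ∀ ε : ℝ, 0 < ε → ε ≤ ε₀ →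
      ∃ K : ℕ, ∀ (V : Type) (G : SimpleGraph V) (A B : Finset V),
        Disjoint A B → K ≤ A.card → K ≤ B.card →
        IsRegularPair G A B ε → pairDensity G A B = d₁ →
        ∃ G' : SimpleGraph V, G' ≤ G ∧
          IsRegularPair G' A B (Real.sqrt ε) ∧ |pairDensity G' A B - d₂| ≤ ε := by
  refine ⟨1 / 9, by norm_num, fun ε hε hε₀ => ?_⟩
  obtain ⟨K, hK⟩ := exists_nat_gt (3 / (ε ^ 3 / 4))
  refine ⟨K + 1, fun V G A B hAB hKA hKB hreg hdens => ?_⟩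
  have hsq : Real.sqrt ε ^ 2 = ε := Real.sq_sqrt hε.le
  have hδ : 0 < Real.sqrt ε := Real.sqrt_pos.mpr hε
  have hδ₁ : Real.sqrt ε ≤ 1 / 3 := Real.sqrt_le_iff.mpr ⟨by norm_num, by linarith⟩
  have hd₁₀ : 0 < d₁ := hd₂.trans hd₁₂
  have hp₀ : 0 ≤ d₂ / d₁ := by positivity
  have hp₁ : d₂ / d₁ ≤ 1 := (div_le_one hd₁₀).mpr hd₁₂.le
  have hpd : d₂ / d₁ * d₁ = d₂ := div_mul_cancel₀ _ hd₁₀.ne'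
  have hKA' : (K : ℝ) ≤ #A := by exact_mod_cast (Nat.le_succ K).trans hKA
  have hKB' : (K : ℝ) ≤ #B := by exact_mod_cast (Nat.le_succ K).trans hKB
  have hA₁ : (1 : ℝ) ≤ #A := by exact_mod_cast (Nat.le_add_left 1 K).trans hKA
  have hB₁ : (1 : ℝ) ≤ #B := by exact_mod_cast (Nat.le_add_left 1 K).trans hKB
  have hc : 0 < ε ^ 3 / 4 := by positivity
  rw [div_lt_iff₀ hc] at hK
  have hA₃ : 3 < ε ^ 3 / 4 * #A := by nlinarith
  have hB₃ : 3 < ε ^ 3 / 4 * #B := by nlinarith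
  obtain ⟨G', hG', hnear⟩ := exists_subgraph_pairDensity_near G hAB hp₀ hp₁ hε (by linarith) hδ
    (by omega) (by omega) (by
      rw [hsq]
      have h₁ : 3 * (#B : ℝ) < ε ^ 3 / 4 * #A * #B := by gcongr
      have h₂ : 3 * (#A : ℝ) < ε ^ 3 / 4 * #B * #A := by gcongr
      nlinarith)
  have hAB' := hnear A subset_rfl B subset_rfl (by nlinarith) (by nlinarith)
  rw [hdens, hpd] at hAB'
  refine ⟨G', hG', fun X hX Y hY hXA hYB => ?_, hAB'.le⟩
  have hεδ : 3 * ε ≤ Real.sqrt ε := by nlinarith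
  have hXY := hreg X hX Y hY (hXA.trans' (by gcongr; linarith)) (hYB.trans' (by gcongr; linarith))
  have hXY' := hnear X hX Y hY hXA hYB
  rw [hdens] at hXY
  have hscaled : |d₂ - d₂ / d₁ * pairDensity G X Y| ≤ ε := by
    calc |d₂ - d₂ / d₁ * pairDensity G X Y|
        = d₂ / d₁ * |d₁ - pairDensity G X Y| := by
          rw [← abs_of_nonneg hp₀, ← abs_mul, abs_of_nonneg hp₀, mul_sub, hpd]
      _ ≤ 1 * ε := by gcongr
      _ = ε := one_mul ε
  rw [abs_lt] at hAB' hXY' ⊢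
  rw [abs_le] at hscaled
  constructor <;> linarith
end

section
/- For every real d with 0<d≤1/2 there exists ε₀>0 such that for all ε with 0<ε≤ε₀ and all d₁,d₂ with d ≤ d₁,d₂ ≤ 1/2 and |d₁−d₂| ≤ ε the following holds: if A, B₁, B₂ are pairwise disjoint vertex sets in a graph G such that (A,B₁) is an ε-regular pair of density d₁ and (A,B₂) is an ε-regular pair of density d₂, then (A, B₁∪B₂) is a (√ε, min{d₁,d₂})-regular pair in G. -/
open Finset

theorem pairDensity_nonneg {V : Type*} (G : SimpleGraph V) (A B : Finset V) :
    0 ≤ pairDensity G A B := by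
  unfold pairDensity
  positivity

theorem pairDensity_le_one {V : Type*} (G : SimpleGraph V) (A B : Finset V) :
    pairDensity G A B ≤ 1 := by
  unfold pairDensity
  apply div_le_one_of_le₀ _ (by positivity)
  have h : {e : V × V | e.1 ∈ A ∧ e.2 ∈ B ∧ G.Adj e.1 e.2}.ncard ≤ (A ×ˢ B).card := by
    rw [← Set.ncard_coe_finset]
    refine Set.ncard_le_ncard ?_ (Finset.finite_toSet _)
    rintro ⟨x, y⟩ ⟨hx, hy, -⟩
    simpa using ⟨hx, hy⟩
  rw [Finset.card_product] at h
  exact_mod_cast h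

/-- The density over a disjoint union is the average of the densities, weighted by size. -/
theorem pairDensity_union_mul_card {V : Type*} [DecidableEq V] (G : SimpleGraph V)
    (X : Finset V) {Y Z : Finset V} (hYZ : Disjoint Y Z) :
    pairDensity G X (Y ∪ Z) * ((Y.card : ℝ) + Z.card) =
      pairDensity G X Y * Y.card + pairDensity G X Z * Z.card := by
  have mul_card (W : Finset V) : pairDensity G X W * W.card =
      ({e : V × V | e.1 ∈ X ∧ e.2 ∈ W ∧ G.Adj e.1 e.2}.ncard : ℝ) / X.card := by
    unfold pairDensity
    rcases W.eq_empty_or_nonempty with rfl | hW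
    · simp
    · have : (W.card : ℝ) ≠ 0 := by exact_mod_cast hW.card_pos.ne'
      rw [← div_div, div_mul_cancel₀ _ this]
  have edges_finite (W : Finset V) :
      {e : V × V | e.1 ∈ X ∧ e.2 ∈ W ∧ G.Adj e.1 e.2}.Finite := by
    refine (X ×ˢ W).finite_toSet.subset ?_
    rintro ⟨x, y⟩ ⟨hx, hy, -⟩
    simpa using ⟨hx, hy⟩
  have edges_union : {e : V × V | e.1 ∈ X ∧ e.2 ∈ Y ∪ Z ∧ G.Adj e.1 e.2} =
      {e : V × V | e.1 ∈ X ∧ e.2 ∈ Y ∧ G.Adj e.1 e.2} ∪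
        {e : V × V | e.1 ∈ X ∧ e.2 ∈ Z ∧ G.Adj e.1 e.2} := by
    ext e
    simp only [Set.mem_ofPred_eq, Set.mem_union, Finset.mem_union]
    tauto
  have edges_disjoint : Disjoint {e : V × V | e.1 ∈ X ∧ e.2 ∈ Y ∧ G.Adj e.1 e.2}
      {e : V × V | e.1 ∈ X ∧ e.2 ∈ Z ∧ G.Adj e.1 e.2} :=
    Set.disjoint_left.2 fun _ h h' => Finset.disjoint_left.1 hYZ h.2.1 h'.2.1
  rw [← Nat.cast_add, ← Finset.card_union_of_disjoint hYZ, mul_card, mul_card, mul_card,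
    edges_union, Set.ncard_union_eq edges_disjoint (edges_finite Y) (edges_finite Z),
    Nat.cast_add, add_div]

theorem card_pos_of_pairDensity_pos {V : Type*} {G : SimpleGraph V} {A B : Finset V}
    (h : 0 < pairDensity G A B) : 0 < B.card := by
  rw [Finset.card_pos, Finset.nonempty_iff_ne_empty]
  rintro rfl
  simp [pairDensity] at h

/-- A weighted average stays close to `D` when the first term has small weight and the second
term is close to `D`. -/
theorem abs_sub_average_lt_of_weight_le {d s D P p q y z : ℝ} (hs : 0 < s) (hsd : 2 * s ≤ d)
    (hdD : d ≤ D) (hD : D ≤ 1 / 2) (hp : 0 ≤ p) (hp1 : p ≤ 1) (hy : 0 ≤ y) (hz : 0 < z)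
    (hys : y ≤ s * (y + z)) (hq : |q - D| < 2 * s ^ 2)
    (hP : P * (y + z) = p * y + q * z) : |D - P| < s := by
  have hyz : 0 < y + z := by linarith
  obtain ⟨hq₁, hq₂⟩ := abs_lt.1 hq
  have hz_lo := mul_lt_mul_of_pos_right hq₁ hz
  have hz_hi := mul_lt_mul_of_pos_right hq₂ hz
  have hy_lo : -(1 - d) * y ≤ (p - D) * y := mul_le_mul_of_nonneg_right (by linarith) hy
  have hy_hi : (p - D) * y ≤ (1 - d) * y := mul_le_mul_of_nonneg_right (by linarith) hy
  have hweight : (1 - d) * y ≤ (1 - d) * (s * (y + z)) :=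
    mul_le_mul_of_nonneg_left hys (by linarith)
  have hsmall : 2 * s * (s * (y + z)) ≤ d * (s * (y + z)) :=
    mul_le_mul_of_nonneg_right hsd (by positivity)
  have hsy : 0 ≤ s ^ 2 * y := by positivity
  rw [abs_lt]
  constructor
  · refine lt_of_mul_lt_mul_right ?_ hyz.le
    linarith
  · refine lt_of_mul_lt_mul_right ?_ hyz.le
    linarith

/-- Two averages of nearby quantities are close when each `pᵢ` is near `dᵢ` or has small
weight. -/
theorem abs_sub_average_lt {d s d₁ d₂ D P p₁ p₂ b₁ b₂ y₁ y₂ : ℝ} (hs : 0 < s)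
    (hsd : 2 * s ≤ d) (hd₁ : d ≤ d₁) (hd₁' : d₁ ≤ 1 / 2) (hd₂ : d ≤ d₂) (hd₂' : d₂ ≤ 1 / 2)
    (hdd : |d₁ - d₂| ≤ s ^ 2) (hb₁ : 0 < b₁) (hb₂ : 0 < b₂) (hy₁ : 0 ≤ y₁) (hy₂ : 0 ≤ y₂)
    (hy : s * (b₁ + b₂) ≤ y₁ + y₂) (hD : D * (b₁ + b₂) = d₁ * b₁ + d₂ * b₂)
    (hP : P * (y₁ + y₂) = p₁ * y₁ + p₂ * y₂)
    (hp₁ : 0 ≤ p₁) (hp₁' : p₁ ≤ 1) (hp₂ : 0 ≤ p₂) (hp₂' : p₂ ≤ 1)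
    (h₁ : s ^ 2 * b₁ ≤ y₁ → |d₁ - p₁| < s ^ 2)
    (h₂ : s ^ 2 * b₂ ≤ y₂ → |d₂ - p₂| < s ^ 2) : |D - P| < s := by
  have hb : 0 < b₁ + b₂ := by linarith
  have hypos : 0 < y₁ + y₂ := lt_of_lt_of_le (by positivity) hy
  have hdD : d ≤ D := by
    refine le_of_mul_le_mul_right ?_ hb
    nlinarith
  have hD' : D ≤ 1 / 2 := by
    refine le_of_mul_le_mul_right ?_ hb
    nlinarith
  obtain ⟨hdd₁, hdd₂⟩ := abs_le.1 hdd
  have hdD₁ : |d₁ - D| ≤ s ^ 2 := by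
    rw [abs_le]
    constructor <;> refine le_of_mul_le_mul_right ?_ hb <;> nlinarith
  have hdD₂ : |d₂ - D| ≤ s ^ 2 := by
    rw [abs_le]
    constructor <;> refine le_of_mul_le_mul_right ?_ hb <;> nlinarith
  obtain ⟨_, _⟩ := abs_le.1 hdD₁
  obtain ⟨_, _⟩ := abs_le.1 hdD₂
  have hs1 : s ^ 2 ≤ s / 4 := by nlinarith
  have hsy : s * (s * (b₁ + b₂)) ≤ s * (y₁ + y₂) := mul_le_mul_of_nonneg_left hy hs.le
  have hsb₁ : 0 < s ^ 2 * b₁ := by positivity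
  have hsb₂ : 0 < s ^ 2 * b₂ := by positivity
  have hle₁ : s ^ 2 * b₁ ≤ s / 4 * b₁ := mul_le_mul_of_nonneg_right hs1 hb₁.le
  have hle₂ : s ^ 2 * b₂ ≤ s / 4 * b₂ := mul_le_mul_of_nonneg_right hs1 hb₂.le
  have hsb₁' : 0 < s * b₁ := by positivity
  have hsb₂' : 0 < s * b₂ := by positivity
  by_cases c₁ : s ^ 2 * b₁ ≤ y₁
  · obtain ⟨_, _⟩ := abs_lt.1 (h₁ c₁)
    have hq₁ : |p₁ - D| < 2 * s ^ 2 := abs_lt.2 ⟨by linarith, by linarith⟩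
    by_cases c₂ : s ^ 2 * b₂ ≤ y₂
    · obtain ⟨_, _⟩ := abs_lt.1 (h₂ c₂)
      have lo : (D - s / 2) * (y₁ + y₂) ≤ P * (y₁ + y₂) := by
        have e₁ : (D - s / 2) * y₁ ≤ p₁ * y₁ := mul_le_mul_of_nonneg_right (by linarith) hy₁
        have e₂ : (D - s / 2) * y₂ ≤ p₂ * y₂ := mul_le_mul_of_nonneg_right (by linarith) hy₂
        linarith
      have hi : P * (y₁ + y₂) ≤ (D + s / 2) * (y₁ + y₂) := by
        have e₁ : p₁ * y₁ ≤ (D + s / 2) * y₁ := mul_le_mul_of_nonneg_right (by linarith) hy₁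
        have e₂ : p₂ * y₂ ≤ (D + s / 2) * y₂ := mul_le_mul_of_nonneg_right (by linarith) hy₂
        linarith
      have lo' := le_of_mul_le_mul_right lo hypos
      have hi' := le_of_mul_le_mul_right hi hypos
      exact abs_lt.2 ⟨by linarith, by linarith⟩
    · rw [not_le] at c₂
      refine abs_sub_average_lt_of_weight_le (p := p₂) (q := p₁) (y := y₂) (z := y₁)
        hs hsd hdD hD' hp₂ hp₂' hy₂ (by linarith) ?_ hq₁ (by linarith)
      linarith
  · rw [not_le] at c₁
    have c₂ : s ^ 2 * b₂ ≤ y₂ := by linarith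
    obtain ⟨_, _⟩ := abs_lt.1 (h₂ c₂)
    refine abs_sub_average_lt_of_weight_le (p := p₁) (q := p₂) (y := y₁) (z := y₂)
      hs hsd hdD hD' hp₁ hp₁' hy₁ (by linarith) ?_ (abs_lt.2 ⟨by linarith, by linarith⟩) hP
    linarith

theorem regular_pair_combining (d : ℝ) (hd : 0 < d) (hd2 : d ≤ 1 / 2) :
    ∃ ε₀ : ℝ, 0 < ε₀ ∧ ∀ ε : ℝ, 0 < ε → ε ≤ ε₀ →
      ∀ d₁ d₂ : ℝ, d ≤ d₁ → d₁ ≤ 1 / 2 → d ≤ d₂ → d₂ ≤ 1 / 2 → |d₁ - d₂| ≤ ε →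
      ∀ (V : Type) [DecidableEq V] (G : SimpleGraph V) (A B₁ B₂ : Finset V),
        Disjoint A B₁ → Disjoint A B₂ → Disjoint B₁ B₂ →
        IsRegularPair G A B₁ ε → pairDensity G A B₁ = d₁ →
        IsRegularPair G A B₂ ε → pairDensity G A B₂ = d₂ →
        IsRegularPair G A (B₁ ∪ B₂) (Real.sqrt ε) ∧
          min d₁ d₂ ≤ pairDensity G A (B₁ ∪ B₂) := by
  refine ⟨(d / 2) ^ 2, by positivity, ?_⟩
  intro ε hε hεd d₁ d₂ hd₁ hd₁' hd₂ hd₂' hdd V _ G A B₁ B₂ _ _ hB hreg₁ hden₁ hreg₂ hden₂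
  have hs : 0 < √ε := Real.sqrt_pos.2 hε
  have hsq : √ε ^ 2 = ε := Real.sq_sqrt hε.le
  have hsd : √ε ≤ d / 2 := (Real.sqrt_le_left (by positivity)).2 hεd
  have hb₁ : (0 : ℝ) < B₁.card := by
    exact_mod_cast card_pos_of_pairDensity_pos (hden₁ ▸ hd.trans_le hd₁)
  have hb₂ : (0 : ℝ) < B₂.card := by
    exact_mod_cast card_pos_of_pairDensity_pos (hden₂ ▸ hd.trans_le hd₂)
  have hD := pairDensity_union_mul_card G A hB
  rw [hden₁, hden₂] at hD
  refine ⟨fun X hX Y hY hXcard hYcard => ?_, ?_⟩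
  · have hXε : ε * A.card ≤ X.card :=
      (mul_le_mul_of_nonneg_right (by nlinarith) A.card.cast_nonneg).trans hXcard
    have hYdisj : Disjoint (Y ∩ B₁) (Y ∩ B₂) :=
      hB.mono Finset.inter_subset_right Finset.inter_subset_right
    have hYunion : Y ∩ B₁ ∪ Y ∩ B₂ = Y := by
      rw [← Finset.inter_union_distrib_left, Finset.inter_eq_left.2 hY]
    have hYsum : (Y.card : ℝ) = (Y ∩ B₁).card + (Y ∩ B₂).card := by
      rw [← Nat.cast_add, ← Finset.card_union_of_disjoint hYdisj, hYunion]
    have hP := pairDensity_union_mul_card G X hYdisj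
    rw [hYunion] at hP
    rw [Finset.card_union_of_disjoint hB, Nat.cast_add, hYsum] at hYcard
    refine abs_sub_average_lt hs (by linarith) hd₁ hd₁' hd₂ hd₂' (hsq.symm ▸ hdd) hb₁ hb₂
      (Nat.cast_nonneg _) (Nat.cast_nonneg _) hYcard hD hP
      (pairDensity_nonneg ..) (pairDensity_le_one ..) (pairDensity_nonneg ..)
      (pairDensity_le_one ..) ?_ ?_
    · rw [hsq, ← hden₁]
      exact hreg₁ X hX _ Finset.inter_subset_right hXε
    · rw [hsq, ← hden₂]
      exact hreg₂ X hX _ Finset.inter_subset_right hXε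
  · refine le_of_mul_le_mul_right ?_ (add_pos hb₁ hb₂)
    rw [hD, mul_add]
    exact add_le_add (mul_le_mul_of_nonneg_right (min_le_left ..) hb₁.le)
      (mul_le_mul_of_nonneg_right (min_le_right ..) hb₂.le)
end

section
/- Let n ≥ k ≥ 2 be integers and let A₁, A₂, …, A_k be nonempty pairwise disjoint subsets of [n]={1,…,n}. Then there exist sets S₁,…,S_k with S_i ⊆ A_i for each i, and a permutation σ of [k], such that: (i) |S_i| ≥ |A_i|/2^{2^{k−2}} for every i ∈ [k]; and (ii) for all i,j ∈ [k], if σ(i) < σ(j) then every element of S_i is smaller than every element of S_j. -/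
open Finset

/-- Among finitely many disjoint finite sets `B i` with `0 < c i ≤ #(B i)`, one set has an initial
segment, cut at some `t`, of size at least `c i`, while every other set has fewer than `c j`
elements up to `t`. -/
theorem exists_initial_segment {ι α : Type*} [LinearOrder α] (c : ι → ℝ) {I : Finset ι}
    (hI : I.Nonempty) (hc : ∀ i ∈ I, 0 < c i) (B : ι → Finset α)
    (hB : ∀ i ∈ I, c i ≤ (B i).card) (hd : (I : Set ι).PairwiseDisjoint B) :
    ∃ i ∈ I, ∃ t : α, c i ≤ ((B i).filter (· ≤ t)).card ∧
      ∀ j ∈ I, j ≠ i → (((B j).filter (· ≤ t)).card : ℝ) < c j := by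
  classical
  set T := (I.biUnion B).filter fun t => ∃ i ∈ I, c i ≤ ((B i).filter (· ≤ t)).card
  have up : ∀ i ∈ I, ∀ X ⊆ B i, c i ≤ (X.card : ℝ) → ∃ s ∈ X, s ∈ T := by
    intro i hi X hX hcX
    have hne : X.Nonempty := by
      rw [← Finset.card_pos]
      exact_mod_cast (hc i hi).trans_le hcX
    have hsub : X ⊆ (B i).filter (· ≤ X.max' hne) := fun x hx =>
      Finset.mem_filter.2 ⟨hX hx, X.le_max' x hx⟩
    refine ⟨X.max' hne, X.max'_mem hne, Finset.mem_filter.2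
      ⟨Finset.mem_biUnion.2 ⟨i, hi, hX (X.max'_mem hne)⟩, i, hi, hcX.trans ?_⟩⟩
    exact_mod_cast Finset.card_le_card hsub
  have hTne : T.Nonempty := by
    obtain ⟨i, hi⟩ := hI
    obtain ⟨s, -, hs⟩ := up i hi (B i) subset_rfl (hB i hi)
    exact ⟨s, hs⟩
  set t := T.min' hTne
  obtain ⟨htB, i, hi, hit⟩ := Finset.mem_filter.1 (T.min'_mem hTne)
  have large : ∀ j ∈ I, c j ≤ ((B j).filter (· ≤ t)).card → t ∈ B j := by
    intro j hj hjt
    obtain ⟨s, hsX, hs⟩ := up j hj _ (Finset.filter_subset _ _) hjt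
    obtain ⟨hsB, hst⟩ := Finset.mem_filter.1 hsX
    rwa [← le_antisymm hst (T.min'_le s hs)]
  refine ⟨i, hi, t, hit, fun j hj hji => ?_⟩
  by_contra! h
  exact Finset.disjoint_left.1 (hd hj hi hji) (large j hj h) (large i hi hit)

/-- Disjoint finite sets with `#(B i) ≥ #I * c i` contain subsets of sizes at least `c i` that
are linearly ordered as blocks. -/
theorem exists_ordered_subsets {ι α : Type*} [LinearOrder α] (c : ι → ℝ) (m : ℕ) :
    ∀ (I : Finset ι), I.card = m → (∀ i ∈ I, 0 < c i) → ∀ B : ι → Finset α,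
      (∀ i ∈ I, m * c i ≤ (B i).card) → (I : Set ι).PairwiseDisjoint B →
      ∃ (S : ι → Finset α) (r : ι → ℕ), (∀ i ∈ I, S i ⊆ B i) ∧
        (∀ i ∈ I, c i ≤ (S i).card) ∧ Set.InjOn r I ∧
        ∀ i ∈ I, ∀ j ∈ I, r i < r j → ∀ a ∈ S i, ∀ b ∈ S j, a < b := by
  classical
  induction m with
  | zero =>
    intro I hI _ B _ _
    obtain rfl := Finset.card_eq_zero.1 hI
    exact ⟨B, fun _ => 0, by simp⟩
  | succ m ih =>
    intro I hI hc B hB hd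
    push_cast at hB
    obtain ⟨i, hi, t, hit, hlt⟩ := exists_initial_segment c (Finset.card_pos.1 (by omega)) hc B
      (fun i hi => by nlinarith [hB i hi, hc i hi, (Nat.cast_nonneg m : (0 : ℝ) ≤ m)]) hd
    obtain ⟨S, r, hS, hcS, hr, hord⟩ := ih (I.erase i)
      (by rw [Finset.card_erase_of_mem hi]; omega)
      (fun j hj => hc j (Finset.mem_of_mem_erase hj)) (fun j => (B j).filter (¬ · ≤ t))
      (fun j hj => by
        obtain ⟨hji, hj⟩ := Finset.mem_erase.1 hj
        have h := Finset.card_filter_add_card_filter_not (s := B j) (· ≤ t)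
        have h' : (((B j).filter (· ≤ t)).card : ℝ) + ((B j).filter (¬ · ≤ t)).card
          = (B j).card := by exact_mod_cast h
        linarith [hlt j hj hji, hB j hj])
      (fun j hj l hl hjl => Finset.disjoint_filter_filter
        (hd (Finset.mem_of_mem_erase hj) (Finset.mem_of_mem_erase hl) hjl))
    refine ⟨fun j => if j = i then (B i).filter (· ≤ t) else S j,
      fun j => if j = i then 0 else r j + 1, fun j hj => ?_, fun j hj => ?_, ?_, ?_⟩
    · by_cases h : j = i
      · subst h; simp
      · simpa [h] using (hS j (Finset.mem_erase.2 ⟨h, hj⟩)).trans (Finset.filter_subset _ _)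
    · by_cases h : j = i
      · subst h; simpa using hit
      · simpa [h] using hcS j (Finset.mem_erase.2 ⟨h, hj⟩)
    · intro j hj l hl hjl
      by_cases h : j = i <;> by_cases h' : l = i <;> simp [h, h'] at hjl ⊢
      exact hr (Finset.mem_erase.2 ⟨h, hj⟩) (Finset.mem_erase.2 ⟨h', hl⟩) hjl
    · intro j hj l hl hjl a ha b hb
      by_cases h' : l = i
      · simp [h'] at hjl
      have hl' := Finset.mem_erase.2 ⟨h', hl⟩
      by_cases h : j = i
      · simp only [h, h', if_true, if_false] at ha hb
        have := (Finset.mem_filter.1 (hS l hl' hb)).2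
        exact (Finset.mem_filter.1 ha).2.trans_lt (not_le.1 this)
      · simp only [h, h', if_false] at ha hb hjl
        exact hord j (Finset.mem_erase.2 ⟨h, hj⟩) l hl' (by omega) a ha b hb

theorem le_two_pow_two_pow_sub_two {k : ℕ} (hk : 2 ≤ k) : k ≤ 2 ^ 2 ^ (k - 2) := by
  obtain ⟨m, rfl⟩ := Nat.exists_eq_add_of_le' hk
  have h1 : m + 1 ≤ 2 ^ m := Nat.lt_two_pow_self
  have h2 : m + 1 < 2 ^ (m + 1) := Nat.lt_two_pow_self
  exact h2.trans_le (Nat.pow_le_pow_right two_pos h1)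

theorem ordered_subsets_lemma (n k : ℕ) (hk : 2 ≤ k) (hkn : k ≤ n)
    (A : Fin k → Finset (Fin n)) (hne : ∀ i, (A i).Nonempty)
    (hdisj : ∀ i j : Fin k, i ≠ j → Disjoint (A i) (A j)) :
    ∃ (S : Fin k → Finset (Fin n)) (σ : Equiv.Perm (Fin k)),
      (∀ i, S i ⊆ A i) ∧
      (∀ i, ((A i).card : ℝ) / 2 ^ (2 ^ (k - 2)) ≤ ((S i).card : ℝ)) ∧
      (∀ i j : Fin k, σ i < σ j → ∀ a ∈ S i, ∀ b ∈ S j, a < b) := by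
  have hk0 : (0 : ℝ) < k := by exact_mod_cast (by omega : 0 < k)
  have hpow : (k : ℝ) ≤ 2 ^ 2 ^ (k - 2) := by exact_mod_cast le_two_pow_two_pow_sub_two hk
  obtain ⟨S, r, hS, hcS, hr, hord⟩ := exists_ordered_subsets
    (fun i => ((A i).card : ℝ) / k) k Finset.univ (by simp)
    (fun i _ => div_pos (by exact_mod_cast (hne i).card_pos) hk0) A
    (fun i _ => (mul_div_cancel₀ _ hk0.ne').le) (fun i _ j _ hij => hdisj i j hij)
  refine ⟨S, (Tuple.sort r)⁻¹, fun i => hS i (Finset.mem_univ i), fun i => ?_, fun i j hij => ?_⟩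
  · refine le_trans ?_ (hcS i (Finset.mem_univ i))
    exact div_le_div_of_nonneg_left (Nat.cast_nonneg _) hk0 hpow
  · refine hord i (Finset.mem_univ i) j (Finset.mem_univ j) (lt_of_le_of_ne ?_ fun h => ?_)
    · simpa using Tuple.monotone_sort r hij.le
    · exact hij.ne (congrArg _ (hr (by simp) (by simp) h))
end

section
/- Let H be an ordered graph on h vertices with at least one edge. There exists η₀>0 (depending on h) such that for every η with 0<η≤η₀ and every γ>0 there exist n₀∈ℕ and ρ>0 with the following property. Let G be an ordered graph on vertex set [n] with n ≥ n₀ and minimum degree δ(G) ≥ (1 − 1/χ<(H) + η)n. Then for every x ∈ [n] there are at least (1−γ)·|B_{[n]}(x, ηn/16)| elements y ∈ B_{[n]}(x, ηn/16) such that there are at least ρn^{h−1} sets X ⊆ [n]∖{x,y} of size h−1 for which both G[X∪{x}] and G[X∪{y}] contain spanning copies of H. -/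
open Finset

lemma pow_mean_le_mean_pow {ι : Type*} [Fintype ι] [Nonempty ι] (f : ι → ℝ)
    (hf : ∀ i, 0 ≤ f i) (k : ℕ) :
    ((∑ i, f i) / Fintype.card ι) ^ k ≤ (∑ i, f i ^ k) / Fintype.card ι := by
  have h0 : (Fintype.card ι : ℝ) ≠ 0 := by exact_mod_cast Fintype.card_ne_zero
  have := Real.pow_arith_mean_le_arith_mean_pow univ (fun _ : ι => (Fintype.card ι : ℝ)⁻¹) f
    (fun _ _ => by positivity) (by simp [h0]) (fun i _ => hf i) k
  simpa only [← Finset.mul_sum, div_eq_inv_mul] using this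

open Classical in
/-- A set of `r`-tuples of density `d` contains the transversals of at least a proportion
`d ^ ∏ |T k|` of the families of vertices indexed by the parts `T k`. -/
lemma pow_density_le_density_blowup {V : Type*} [Fintype V] [Nonempty V] (r : ℕ)
    (T : Fin r → Type) [∀ k, Fintype (T k)] (S : Finset (Fin r → V)) :
    ((#S : ℝ) / (Fintype.card V : ℝ) ^ r) ^ (∏ k, Fintype.card (T k)) ≤
      (#{w : ∀ k, T k → V | ∀ s : ∀ k, T k, (fun k => w k (s k)) ∈ S} : ℝ) /
        ∏ k, (Fintype.card V : ℝ) ^ Fintype.card (T k) := by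
  induction r with
  | zero =>
    simp only [pow_zero, div_one, univ_eq_empty, prod_empty, pow_one]
    norm_cast
    refine Finset.card_le_card_of_injOn (fun _ k => k.elim0) ?_ ?_
    · intro p hp
      simp only [coe_filter, mem_univ, true_and, Set.mem_ofPred_eq]
      intro s
      rw [Subsingleton.elim (fun k => _) p]
      exact hp
    · intro p _ q _ _
      exact Subsingleton.elim _ _
  | succ r ih =>
    have hN : (0 : ℝ) < Fintype.card V := by exact_mod_cast Fintype.card_pos
    set N : ℝ := (Fintype.card V : ℝ) with hNdef
    let Sq : (T 0 → V) → Finset (Fin r → V) :=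
      fun q => {p | ∀ j, (Fin.cons (q j) p : Fin (r + 1) → V) ∈ S}
    let d : (Fin r → V) → ℕ := fun p => #{v | (Fin.cons v p : Fin (r + 1) → V) ∈ S}
    have hd : ∑ p, d p = #S := by
      have e : #S = #{a : V × (Fin r → V) | (Fin.cons a.1 a.2 : Fin (r + 1) → V) ∈ S} := by
        symm
        refine Finset.card_bij (fun a _ => Fin.cons a.1 a.2) ?_ ?_ ?_
        · intro a ha; simpa using ha
        · rintro ⟨a, p⟩ _ ⟨b, q⟩ _ hab
          simpa [Fin.cons_inj] using hab
        · intro u hu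
          exact ⟨(u 0, Fin.tail u), by simpa using hu, by simp⟩
      rw [e, Finset.card_filter, Fintype.sum_prod_type_right]
      simp only [d, Finset.card_filter]
    have hSq : ∑ q, #(Sq q) = ∑ p, d p ^ Fintype.card (T 0) := by
      simp only [Sq, Finset.card_filter]
      rw [Finset.sum_comm]
      refine Finset.sum_congr rfl fun p _ => ?_
      rw [← Finset.card_filter]
      have : (univ.filter fun q : T 0 → V => ∀ j, (Fin.cons (q j) p : Fin (r + 1) → V) ∈ S) =
          Fintype.piFinset fun _ : T 0 => univ.filter
            fun v => (Fin.cons v p : Fin (r + 1) → V) ∈ S := by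
        ext q; simp
      simp [this, Fintype.card_piFinset, d]
    have hcount : ∑ q, #{w : ∀ k : Fin r, T k.succ → V |
          ∀ s : ∀ k : Fin r, T k.succ, (fun k => w k (s k)) ∈ Sq q} ≤
        #{w : ∀ k, T k → V | ∀ s : ∀ k, T k, (fun k => w k (s k)) ∈ S} := by
      rw [← Finset.card_sigma]
      refine Finset.card_le_card_of_injOn
        (fun a => (Fin.cons a.1 a.2 : ∀ k : Fin (r + 1), T k → V)) ?_ ?_
      · rintro ⟨q, w⟩ ha
        simp only [coe_sigma, Set.mem_sigma_iff, coe_filter, mem_univ, true_and,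
          Set.mem_ofPred_eq, coe_univ, Set.mem_univ] at ha ⊢
        intro s
        have := ha (fun k => s k.succ)
        simp only [Sq, mem_filter, mem_univ, true_and] at this
        convert this (s 0) using 1
        funext k
        refine Fin.cases ?_ (fun k => ?_) k <;> simp
      · rintro ⟨q, w⟩ _ ⟨q', w'⟩ _ hab
        obtain ⟨rfl, rfl⟩ := (Fin.cons_inj (α := fun k => T k → V)).1 hab
        rfl
    have J1 : (#S / N ^ (r + 1)) ^ Fintype.card (T 0) ≤
        (∑ q, (#(Sq q) : ℝ) / N ^ r) / N ^ Fintype.card (T 0) := by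
      have := pow_mean_le_mean_pow (fun p => (d p : ℝ) / N) (fun p => by positivity)
        (Fintype.card (T 0))
      rw [← Finset.sum_div] at this
      simp only [div_pow, ← Finset.sum_div] at this ⊢
      have h1 : (∑ p, (d p : ℝ)) = #S := by exact_mod_cast hd
      have h2 : (∑ p, (d p : ℝ) ^ Fintype.card (T 0)) = ∑ q, (#(Sq q) : ℝ) := by
        exact_mod_cast hSq.symm
      rw [h1, h2] at this
      have hc : (Fintype.card (Fin r → V) : ℝ) = N ^ r := by simp [hNdef]
      rw [hc] at this
      calc _ = (#S : ℝ) ^ Fintype.card (T 0) / N ^ Fintype.card (T 0) /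
                (N ^ r) ^ Fintype.card (T 0) := by
            rw [pow_succ, mul_pow, div_div]; congr 1; ring
        _ ≤ _ := this
        _ = _ := by rw [div_div, div_div, mul_comm]
    rw [Fin.prod_univ_succ, Fin.prod_univ_succ, pow_mul]
    refine (pow_le_pow_left₀ (by positivity) J1 _).trans ?_
    have J2 := pow_mean_le_mean_pow (fun q => (#(Sq q) : ℝ) / N ^ r) (fun p => by positivity)
        (∏ k : Fin r, Fintype.card (T k.succ))
    have hc : (Fintype.card (T 0 → V) : ℝ) = N ^ Fintype.card (T 0) := by simp [hNdef]
    rw [hc] at J2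
    refine J2.trans ?_
    rw [mul_comm (N ^ _), ← div_div]
    gcongr
    refine (Finset.sum_le_sum fun q _ => ih (fun k => T k.succ) (Sq q)).trans ?_
    rw [← Finset.sum_div]
    gcongr
    exact_mod_cast hcount

/-- An optimal interval colouring uses all of its colours. -/
lemma exists_surjective_intervalColoring {h : ℕ} (H : SimpleGraph (Fin h)) :
    ∃ c : Fin h → Fin (intervalChi H), Monotone c ∧ (∀ i j : Fin h, H.Adj i j → c i ≠ c j) ∧
      Function.Surjective c := by
  have hmem : intervalChi H ∈ {k | HasIntervalColoring H k} :=
    Nat.sInf_mem ⟨h, id, monotone_id, fun i j hij => hij.ne⟩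
  obtain ⟨c, hc, hH⟩ := hmem
  refine ⟨c, hc, hH, fun k => ?_⟩
  by_contra! hk
  obtain ⟨r, hr⟩ : ∃ r, intervalChi H = r + 1 := ⟨intervalChi H - 1, by have := k.isLt; omega⟩
  have hlt : ¬ HasIntervalColoring H r := Nat.notMem_of_lt_sInf (s := {k | HasIntervalColoring H k})
    (by change r < intervalChi H; omega)
  revert c k
  rw [hr]
  intro c hc hH k hk
  choose d hd using fun i => Fin.exists_succAbove_eq (hk i)
  refine hlt ⟨d, fun i j hij => ?_, fun i j hij heq => hH i j hij ?_⟩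
  · have := hc hij
    rwa [← hd i, ← hd j, Fin.succAbove_le_succAbove_iff] at this
  · rw [← hd i, ← hd j, heq]

/-- A map that respects the interval classes, though not necessarily the order inside them,
and sends pairs in distinct classes to edges has the vertex set of a copy as its image. -/
lemma isCopySet_image {h n r : ℕ} {H : SimpleGraph (Fin h)} {G : SimpleGraph (Fin n)}
    {col : Fin h → Fin r} (hcol : Monotone col) (hH : ∀ i j, H.Adj i j → col i ≠ col j)
    {β : Fin n → ℤ} (hβ : Monotone β) {c : Fin r → ℤ} (hc : StrictMono c)
    {ψ : Fin h → Fin n} (hψ : Function.Injective ψ) (hblock : ∀ a, β (ψ a) = c (col a))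
    (hadj : ∀ a b, col a ≠ col b → G.Adj (ψ a) (ψ b)) :
    IsCopySet H G (image ψ univ) := by
  set τ := Tuple.sort ψ
  have hτ : Monotone (ψ ∘ τ) := Tuple.monotone_sort ψ
  have hm : Monotone (col ∘ τ) := fun i j hij => by
    have := hβ (hτ hij)
    simp only [Function.comp_apply, hblock] at this
    exact hc.le_iff_le.1 this
  have heq : col ∘ τ = col := by
    simpa using Tuple.unique_monotone (τ := Equiv.refl (Fin h)) hm (by simpa using hcol)
  refine ⟨ψ ∘ τ, ⟨hτ.strictMono_of_injective (hψ.comp τ.injective), fun i j hij => ?_⟩, ?_⟩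
  · refine hadj _ _ ?_
    have hi := congrFun heq i
    have hj := congrFun heq j
    simp only [Function.comp_apply] at hi hj
    rw [hi, hj]
    exact hH i j hij
  · rw [← Finset.image_image, Finset.image_univ_equiv]

/-- `u` is a clique with vertices in distinct blocks of `β`, whose vertex in the block `0`
exists and belongs to `B` and whose other vertices are neighbours of `x`. -/
def IsGoodClique {n : ℕ} (G : SimpleGraph (Fin n)) (β : Fin n → ℤ) (B : Finset (Fin n))
    (x : Fin n) {ι : Type*} (u : ι → Fin n) : Prop :=
  Function.Injective (β ∘ u) ∧ (∀ i j, i ≠ j → G.Adj (u i) (u j)) ∧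
    (∀ i, β (u i) = 0 → u i ∈ B) ∧ (∀ i, β (u i) ≠ 0 → G.Adj x (u i)) ∧ ∃ i, β (u i) = 0

lemma IsGoodClique.comp_equiv {n : ℕ} {G : SimpleGraph (Fin n)} {β : Fin n → ℤ}
    {B : Finset (Fin n)} {x : Fin n} {ι κ : Type*} {u : ι → Fin n}
    (hu : IsGoodClique G β B x u) (e : κ ≃ ι) : IsGoodClique G β B x (u ∘ e) := by
  obtain ⟨h1, h2, h3, h4, i, hi⟩ := hu
  refine ⟨h1.comp e.injective, fun i j hij => h2 _ _ (e.injective.ne hij), fun i => h3 _,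
    fun i => h4 _, e.symm i, by simpa using hi⟩

open Classical in
lemma card_not_adj_le {n : ℕ} {G : SimpleGraph (Fin n)} {d : ℝ} {v : Fin n}
    (hd : d ≤ odeg G v) : (#{w | ¬ G.Adj v w} : ℝ) ≤ n - d := by
  have h1 := Finset.card_filter_add_card_filter_not (s := (univ : Finset (Fin n)))
    (fun w => G.Adj v w)
  have h2 : odeg G v = #{w | G.Adj v w} := by
    rw [odeg, ← Set.ncard_coe_finset]
    congr 1
    ext w; simp
  have h3 : (#{w | G.Adj v w} : ℝ) + #{w | ¬ G.Adj v w} = n := by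
    rw [card_univ, Fintype.card_fin] at h1
    exact_mod_cast h1
  rw [h2] at hd
  linarith

open Classical in
lemma le_card_extend_goodClique {n r k : ℕ} {η : ℝ} (hk : k + 1 ≤ r) {G : SimpleGraph (Fin n)}
    (hG : ∀ v, (1 - 1 / (r : ℝ) + η) * n ≤ odeg G v) {β : Fin n → ℤ}
    (hfib : ∀ j, (#{v | β v = j} : ℝ) ≤ η * n) {B : Finset (Fin n)} {x : Fin n}
    {u : Fin k → Fin n} (hu : IsGoodClique G β B x u) :
    η * n ≤ #{v | IsGoodClique G β B x (Fin.cons v u : Fin (k + 1) → Fin n)} := by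
  obtain ⟨h1, h2, h3, h4, i₀, h5⟩ := hu
  set good : Finset (Fin n) := {v | IsGoodClique G β B x (Fin.cons v u : Fin (k + 1) → Fin n)}
  have hsub : goodᶜ ⊆ univ.filter (fun w => ¬ G.Adj x w) ∪
      univ.biUnion fun i => (univ.filter (fun w => ¬ G.Adj (u i) w) ∪
        univ.filter fun w => β w = β (u i)) := by
    intro v hv
    by_contra hcon
    simp only [mem_union, mem_filter, mem_univ, true_and, mem_biUnion, not_or, not_exists,
      not_not] at hcon
    obtain ⟨ha, hb⟩ := hcon
    refine (mem_compl.1 hv) (mem_filter.2 ⟨mem_univ _, ?_, ?_, ?_, ?_, ?_⟩)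
    · intro i j hij
      induction i using Fin.cases <;> induction j using Fin.cases
      · rfl
      · exact absurd hij (hb _).2
      · exact absurd hij.symm (hb _).2
      · exact congrArg Fin.succ (h1 hij)
    · intro i j hij
      induction i using Fin.cases <;> induction j using Fin.cases
      · exact absurd rfl hij
      · exact (hb _).1.symm
      · exact (hb _).1
      · exact h2 _ _ fun h => hij (congrArg Fin.succ h)
    · intro i
      induction i using Fin.cases
      · intro h0
        exact absurd (h0.trans h5.symm) (hb i₀).2
      · exact h3 _
    · intro i
      induction i using Fin.cases
      · exact fun _ => ha
      · exact h4 _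
    · exact ⟨i₀.succ, h5⟩
  have hc1 : (#goodᶜ : ℝ) ≤ (1 / r - η) * n + k * ((1 / r - η) * n + η * n) := by
    have hadj : ∀ v, (#{w | ¬ G.Adj v w} : ℝ) ≤ (1 / r - η) * n := fun v =>
      (card_not_adj_le (hG v)).trans_eq (by ring)
    calc (#goodᶜ : ℝ) ≤ #{w | ¬ G.Adj x w} + ∑ i : Fin k, ((#{w | ¬ G.Adj (u i) w} : ℝ) +
          #{w | β w = β (u i)}) := by
          refine (Nat.cast_le.2 ((card_le_card hsub).trans ((card_union_le _ _).trans
            (add_le_add_right (card_biUnion_le.trans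
              (sum_le_sum fun i _ => card_union_le _ _)) _)))).trans ?_
          push_cast
          rfl
      _ ≤ (1 / r - η) * n + ∑ i : Fin k, ((1 / r - η) * n + η * n) := by
          gcongr
          · exact hadj x
          · exact hadj _
          · exact hfib _
      _ = _ := by simp [mul_add]
  have hc2 : (#good : ℝ) + #goodᶜ = n := by
    have := card_add_card_compl good
    rw [Fintype.card_fin] at this
    exact_mod_cast this
  have hr : (0 : ℝ) < r := by exact_mod_cast (by omega : 0 < r)
  have hkr : ((k : ℝ) + 1) * (1 / r * n) ≤ n := by
    have : ((k : ℝ) + 1) ≤ r := by exact_mod_cast hk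
    calc ((k : ℝ) + 1) * (1 / r * n) ≤ r * (1 / r * n) := by gcongr
      _ = n := by field_simp
  nlinarith

open Classical in
lemma le_card_goodClique {n r k : ℕ} {η : ℝ} (hη : 0 < η) (hk : k + 1 ≤ r)
    {G : SimpleGraph (Fin n)}
    (hG : ∀ v, (1 - 1 / (r : ℝ) + η) * n ≤ odeg G v) {β : Fin n → ℤ}
    (hfib : ∀ j, (#{v | β v = j} : ℝ) ≤ η * n) {B : Finset (Fin n)} (hB : ∀ y ∈ B, β y = 0)
    {x : Fin n} :
    #B * (η * n) ^ k ≤ #{u : Fin (k + 1) → Fin n | IsGoodClique G β B x u} := by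
  induction k with
  | zero =>
    have : Subsingleton (Fin (0 + 1)) := inferInstanceAs (Subsingleton (Fin 1))
    simp only [pow_zero, mul_one]
    norm_cast
    refine card_le_card_of_injOn (fun y _ => y) (fun y hy => ?_) fun y _ z _ hyz => congrFun hyz 0
    simp only [coe_filter, mem_univ, true_and, Set.mem_ofPred_eq]
    refine ⟨Function.injective_of_subsingleton _, fun i j hij => absurd (Subsingleton.elim i j) hij,
      fun _ _ => hy, fun _ h => absurd (hB y hy) h, 0, hB y hy⟩
  | succ k ih =>
    have h1 : ∑ u : Fin (k + 1) → Fin n with IsGoodClique G β B x u,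
        #{v | IsGoodClique G β B x (Fin.cons v u : Fin (k + 1 + 1) → Fin n)} ≤
        #{u : Fin (k + 1 + 1) → Fin n | IsGoodClique G β B x u} := by
      rw [← card_sigma]
      refine card_le_card_of_injOn (fun a => Fin.cons a.2 a.1) ?_ ?_
      · rintro ⟨u, v⟩ ha
        simp only [coe_sigma, Set.mem_sigma_iff, coe_filter, mem_univ, true_and,
          Set.mem_ofPred_eq] at ha ⊢
        exact ha.2
      · rintro ⟨u, v⟩ _ ⟨u', v'⟩ _ hab
        obtain ⟨rfl, rfl⟩ := (Fin.cons_inj (α := fun _ => Fin n)).1 hab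
        rfl
    calc _ = (#B * (η * n) ^ k) * (η * n) := by ring
      _ ≤ #{u : Fin (k + 1) → Fin n | IsGoodClique G β B x u} * (η * n) := by
          gcongr; exact ih (by omega)
      _ = ∑ u : Fin (k + 1) → Fin n with IsGoodClique G β B x u, η * n := by simp
      _ ≤ ∑ u : Fin (k + 1) → Fin n with IsGoodClique G β B x u,
        (#{v | IsGoodClique G β B x (Fin.cons v u : Fin (k + 1 + 1) → Fin n)} : ℝ) :=
          sum_le_sum fun u hu => le_card_extend_goodClique hk hG hfib (mem_filter.1 hu).2
      _ ≤ _ := by exact_mod_cast h1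

open Classical in
/-- Many good cliques yield many good cliques with a common increasing pattern of blocks. -/
lemma exists_strictMono_block_pattern {n r M : ℕ} (hn : 0 < n) {ε : ℝ} (hε : 0 < ε)
    {G : SimpleGraph (Fin n)} {β : Fin n → ℤ} (hM : ∀ v, |β v| ≤ M) {B : Finset (Fin n)}
    {x : Fin n} (hT : ε * n ^ r ≤ #{u : Fin r → Fin n | IsGoodClique G β B x u}) :
    ∃ c : Fin r → ℤ, StrictMono c ∧
      ε / (2 * M + 1) ^ r * n ^ r ≤
        #{u : Fin r → Fin n | IsGoodClique G β B x u ∧ β ∘ u = c} := by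
  have hmaps : ∀ u ∈ univ.filter fun u : Fin r → Fin n => IsGoodClique G β B x u,
      β ∘ u ∈ Fintype.piFinset fun _ : Fin r => Icc (-(M : ℤ)) M := by
    intro u _
    simp only [Fintype.mem_piFinset, mem_Icc, Function.comp_apply]
    exact fun i => abs_le.1 (hM _)
  have hcard : #(Fintype.piFinset fun _ : Fin r => Icc (-(M : ℤ)) M) = (2 * M + 1) ^ r := by
    rw [Fintype.card_piFinset_const, Int.card_Icc]
    congr 1
    omega
  obtain ⟨c, -, hc⟩ := Finset.exists_le_card_fiber_of_nsmul_le_card_of_maps_to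
    (b := ε / (2 * M + 1) ^ r * n ^ r) hmaps ⟨fun _ => 0, by simp⟩ (by
      rw [hcard, nsmul_eq_mul]
      push_cast
      rw [← mul_assoc, mul_div_cancel₀ _ (by positivity)]
      exact hT)
  rw [Finset.filter_filter] at hc
  have hpos : (0 : ℝ) < ε / (2 * M + 1) ^ r * n ^ r := by positivity
  obtain ⟨u, hu⟩ := Finset.card_pos.1 (Nat.cast_pos.1 (hpos.trans_le hc))
  obtain ⟨hgood, rfl⟩ := (mem_filter.1 hu).2
  refine ⟨_, (Tuple.monotone_sort (β ∘ u)).strictMono_of_injective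
    (hgood.1.comp (Tuple.sort (β ∘ u)).injective), hc.trans (Nat.cast_le.2 ?_)⟩
  refine Finset.card_le_card_of_injOn (fun w => w ∘ Tuple.sort (β ∘ u)) ?_ ?_
  · intro w hw
    simp only [coe_filter, mem_univ, true_and, Set.mem_ofPred_eq] at hw ⊢
    exact ⟨hw.1.comp_equiv _, by rw [← Function.comp_assoc, hw.2]⟩
  · intro w _ w' _ hww
    exact (Tuple.sort (β ∘ u)).surjective.injective_comp_right hww

/-- `ψ` maps the classes of `col` to the blocks listed by `c`, with edges between distinct
classes, so that the class of the block `0` is sent into `B` and all the others to neighbours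
of `x`. -/
def IsBlockHom {h n r : ℕ} (G : SimpleGraph (Fin n)) (β : Fin n → ℤ) (B : Finset (Fin n))
    (x : Fin n) (col : Fin h → Fin r) (c : Fin r → ℤ) (ψ : Fin h → Fin n) : Prop :=
  (∀ a, β (ψ a) = c (col a)) ∧ (∀ a b, col a ≠ col b → G.Adj (ψ a) (ψ b)) ∧
    (∀ a, c (col a) = 0 → ψ a ∈ B) ∧ ∀ a, c (col a) ≠ 0 → G.Adj x (ψ a)

open Classical in
lemma exists_many_blockHoms {h n r M : ℕ} (hn : 0 < n) {ε : ℝ} (hε : 0 < ε)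
    {col : Fin h → Fin r} (hcol : Function.Surjective col)
    {G : SimpleGraph (Fin n)} {β : Fin n → ℤ} (hM : ∀ v, |β v| ≤ M) {B : Finset (Fin n)}
    {x : Fin n} (hT : ε * n ^ r ≤ #{u : Fin r → Fin n | IsGoodClique G β B x u}) :
    ∃ c : Fin r → ℤ, StrictMono c ∧ (∃ a, c (col a) = 0) ∧
      (ε / (2 * M + 1) ^ r) ^ (∏ k, Fintype.card {a // col a = k}) * n ^ h ≤
        #{ψ : Fin h → Fin n | IsBlockHom G β B x col c ψ} := by
  obtain ⟨c, hc, hcard⟩ := exists_strictMono_block_pattern hn hε hM hT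
  have : Nonempty (Fin n) := ⟨⟨0, hn⟩⟩
  have hnr : (0 : ℝ) < n := by exact_mod_cast hn
  set S : Finset (Fin r → Fin n) := {u | IsGoodClique G β B x u ∧ β ∘ u = c}
  have hS : ∀ u ∈ S, IsGoodClique G β B x u ∧ ∀ k, β (u k) = c k := fun u hu =>
    ⟨(mem_filter.1 hu).2.1, congrFun (mem_filter.1 hu).2.2⟩
  have hpos : (0 : ℝ) < ε / (2 * M + 1) ^ r * n ^ r := by positivity
  obtain ⟨u, hu⟩ := Finset.card_pos.1 (Nat.cast_pos.1 (hpos.trans_le hcard))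
  obtain ⟨⟨-, -, -, -, k₀, hk₀⟩, huc⟩ := hS u hu
  obtain ⟨a₀, ha₀⟩ := hcol k₀
  refine ⟨c, hc, ⟨a₀, by rw [ha₀, ← huc, hk₀]⟩, ?_⟩
  have hblow := pow_density_le_density_blowup r (fun k => {a // col a = k}) S
  rw [Fintype.card_fin] at hblow
  have hprod : ∏ k, (n : ℝ) ^ Fintype.card {a // col a = k} = n ^ h := by
    rw [Finset.prod_pow_eq_pow_sum, ← Fintype.card_sigma,
      Fintype.card_congr (Equiv.sigmaFiberEquiv col), Fintype.card_fin]
  rw [hprod, le_div_iff₀ (by positivity)] at hblow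
  have hdens : ε / (2 * M + 1) ^ r ≤ #S / (n : ℝ) ^ r := by
    rw [le_div_iff₀ (by positivity)]
    exact hcard
  calc _ ≤ ((#S : ℝ) / n ^ r) ^ (∏ k, Fintype.card {a // col a = k}) * n ^ h := by gcongr
    _ ≤ _ := hblow
    _ ≤ _ := by
      refine Nat.cast_le.2 (Finset.card_le_card_of_injOn (fun w a => w (col a) ⟨a, rfl⟩) ?_ ?_)
      · intro w hw
        simp only [coe_filter, mem_univ, true_and, Set.mem_ofPred_eq] at hw ⊢
        choose f hf using hcol
        have key : ∀ a b, (col a = col b → a = b) → ∃ u ∈ S,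
            u (col a) = w (col a) ⟨a, rfl⟩ ∧ u (col b) = w (col b) ⟨b, rfl⟩ := by
          intro a b hab
          let s : ∀ k, {a // col a = k} := fun k =>
            if ha : col a = k then ⟨a, ha⟩ else if hb : col b = k then ⟨b, hb⟩ else ⟨f k, hf k⟩
          refine ⟨_, hw s, by simp [s], ?_⟩
          by_cases hcab : col a = col b
          · obtain rfl := hab hcab
            simp [s]
          · simp [s, hcab]
        refine ⟨fun a => ?_, fun a b hab => ?_, fun a ha => ?_, fun a ha => ?_⟩
        · obtain ⟨u, hu, ha, -⟩ := key a a fun _ => rfl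
          dsimp only
          rw [← ha, (hS u hu).2]
        · obtain ⟨u, hu, ha, hb⟩ := key a b fun h => absurd h hab
          dsimp only
          rw [← ha, ← hb]
          exact (hS u hu).1.2.1 _ _ hab
        · obtain ⟨u, hu, hua, -⟩ := key a a fun _ => rfl
          dsimp only
          rw [← hua]
          exact (hS u hu).1.2.2.1 _ (by rw [(hS u hu).2, ha])
        · obtain ⟨u, hu, hua, -⟩ := key a a fun _ => rfl
          dsimp only
          rw [← hua]
          exact (hS u hu).1.2.2.2.1 _ (by rwa [(hS u hu).2])
      · intro w _ w' _ hww
        funext k ⟨a, ha⟩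
        subst ha
        exact congrFun hww a

open Classical in
lemma card_not_injective_le (h n : ℕ) :
    #{ψ : Fin h → Fin n | ¬ Function.Injective ψ} ≤ h ^ 2 * n ^ (h - 1) := by
  have hsub : (univ.filter fun ψ : Fin h → Fin n => ¬ Function.Injective ψ) ⊆
      (univ.filter fun p : Fin h × Fin h => p.1 ≠ p.2).biUnion
        fun p => univ.filter fun ψ : Fin h → Fin n => ψ p.1 = ψ p.2 := by
    intro ψ hψ
    obtain ⟨a, b, hab, hne⟩ := Function.not_injective_iff.1 (mem_filter.1 hψ).2
    simp only [mem_biUnion, mem_filter, mem_univ, true_and, Prod.exists]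
    exact ⟨a, b, hne, hab⟩
  refine (card_le_card hsub).trans ((card_biUnion_le_card_mul _ _ (n ^ (h - 1)) ?_).trans ?_)
  · rintro ⟨a, b⟩ hab
    have hab : a ≠ b := (mem_filter.1 hab).2
    have hc : #(univ : Finset ({i : Fin h // i ≠ a} → Fin n)) = n ^ (h - 1) := by
      simp [Fintype.card_subtype_compl]
    rw [← hc]
    refine card_le_card_of_injOn (fun ψ i => ψ i) (fun _ _ => mem_univ _) ?_
    intro ψ hψ φ hφ hψφ
    have hoff : ∀ i, i ≠ a → ψ i = φ i := fun i hi => congrFun hψφ ⟨i, hi⟩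
    have hψ : ψ a = ψ b := (mem_filter.1 hψ).2
    have hφ : φ a = φ b := (mem_filter.1 hφ).2
    funext i
    by_cases hi : i = a
    · rw [hi, hψ, hφ, hoff b hab.symm]
    · exact hoff i hi
  · gcongr
    refine (card_filter_le _ _).trans_eq ?_
    simp [sq]

/-- The sets that connect `x` to `y`. -/
def IsConnectingSet {h n : ℕ} (H : SimpleGraph (Fin h)) (G : SimpleGraph (Fin n)) (x y : Fin n)
    (X : Finset (Fin n)) : Prop :=
  x ∉ X ∧ y ∉ X ∧ X.card = h - 1 ∧ IsCopySet H G (insert x X) ∧ IsCopySet H G (insert y X)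

lemma IsBlockHom.isConnectingSet {h n r : ℕ} {H : SimpleGraph (Fin h)}
    {G : SimpleGraph (Fin n)} {col : Fin h → Fin r} (hcol : Monotone col)
    (hH : ∀ i j, H.Adj i j → col i ≠ col j) {β : Fin n → ℤ} (hβ : Monotone β)
    {c : Fin r → ℤ} (hc : StrictMono c) {B : Finset (Fin n)} {x : Fin n} (hxB : x ∉ B)
    (hx : β x = 0) {ψ : Fin h → Fin n} (hψ : IsBlockHom G β B x col c ψ)
    (hinj : Function.Injective ψ) {a : Fin h} (ha : c (col a) = 0) :
    IsConnectingSet H G x (ψ a) ((image ψ univ).erase (ψ a)) := by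
  obtain ⟨h1, h2, h3, h4⟩ := hψ
  have hxψ : ∀ b, ψ b ≠ x := by
    intro b hb
    by_cases h0 : c (col b) = 0
    · exact hxB (hb ▸ h3 b h0)
    · exact (h4 b h0).ne hb.symm
  have hcola : ∀ b, col b ≠ col a → G.Adj x (ψ b) := fun b hb =>
    h4 b fun h0 => hb (hc.injective (h0.trans ha.symm))
  have hinj' : Function.Injective (Function.update ψ a x) := by
    intro i j hij
    by_cases hi : i = a <;> by_cases hj : j = a
    · rw [hi, hj]
    · simp only [hi, Function.update_self, Function.update_of_ne hj] at hij
      exact absurd hij.symm (hxψ j)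
    · simp only [hj, Function.update_self, Function.update_of_ne hi] at hij
      exact absurd hij (hxψ i)
    · simp only [Function.update_of_ne hi, Function.update_of_ne hj] at hij
      exact hinj hij
  refine ⟨fun hx => ?_, notMem_erase _ _, ?_, ?_, ?_⟩
  · obtain ⟨b, -, hb⟩ := mem_image.1 (mem_of_mem_erase hx)
    exact hxψ b hb
  · rw [card_erase_of_mem (mem_image_of_mem _ (mem_univ a)), card_image_of_injective _ hinj]
    simp
  · have himage : insert x ((image ψ univ).erase (ψ a)) =
        image (Function.update ψ a x) univ := by
      ext v
      simp only [mem_insert, mem_erase, mem_image, mem_univ, true_and]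
      constructor
      · rintro (rfl | ⟨hv, b, rfl⟩)
        · exact ⟨a, by simp⟩
        · exact ⟨b, Function.update_of_ne (fun hb => hv (by rw [hb])) _ _⟩
      · rintro ⟨b, rfl⟩
        by_cases hb : b = a
        · left; simp [hb]
        · right
          rw [Function.update_of_ne hb]
          exact ⟨hinj.ne hb, b, rfl⟩
    rw [himage]
    refine isCopySet_image hcol hH hβ hc hinj' (fun b => ?_) fun i j hij => ?_
    · by_cases hb : b = a
      · rw [hb, Function.update_self, hx, ha]
      · rw [Function.update_of_ne hb, h1]
    · by_cases hi : i = a <;> by_cases hj : j = a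
      · exact absurd (by rw [hi, hj]) hij
      · rw [hi, Function.update_self, Function.update_of_ne hj]
        exact hcola j (hi ▸ hij.symm)
      · rw [hj, Function.update_self, Function.update_of_ne hi]
        exact (hcola i (hj ▸ hij)).symm
      · rw [Function.update_of_ne hi, Function.update_of_ne hj]
        exact h2 i j hij
  · rw [insert_erase (mem_image_of_mem _ (mem_univ a))]
    exact isCopySet_image hcol hH hβ hc hinj h1 h2

open Classical in
lemma card_injective_blockHom_le {h n r : ℕ} {H : SimpleGraph (Fin h)}
    {G : SimpleGraph (Fin n)} {col : Fin h → Fin r} (hcol : Monotone col)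
    (hH : ∀ i j, H.Adj i j → col i ≠ col j) {β : Fin n → ℤ} (hβ : Monotone β)
    {c : Fin r → ℤ} (hc : StrictMono c) {B : Finset (Fin n)} {x : Fin n} (hxB : x ∉ B)
    (hx : β x = 0) {a : Fin h} (ha : c (col a) = 0) :
    #{ψ : Fin h → Fin n | IsBlockHom G β B x col c ψ ∧ Function.Injective ψ} ≤
      h ^ h * ∑ y ∈ B, #{X | IsConnectingSet H G x y X} := by
  rw [← card_sigma]
  refine card_le_mul_card_image_of_maps_to
    (f := fun ψ => (⟨ψ a, (image ψ univ).erase (ψ a)⟩ : (_ : Fin n) × Finset (Fin n))) ?_ _ ?_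
  · intro ψ hψ
    obtain ⟨hψ, hinj⟩ := (mem_filter.1 hψ).2
    rw [mem_sigma, mem_filter]
    exact ⟨hψ.2.2.1 a ha, mem_univ _, hψ.isConnectingSet hcol hH hβ hc hxB hx hinj ha⟩
  · rintro ⟨y, X⟩ hyX
    have hX := (mem_filter.1 (mem_sigma.1 hyX).2).2
    have hcard : #(insert y X) = h := by
      rw [card_insert_of_notMem hX.2.1, hX.2.2.1]
      have := a.pos
      omega
    calc _ ≤ #(Fintype.piFinset fun _ : Fin h => insert y X) := by
          refine card_le_card fun ψ hψ => Fintype.mem_piFinset.2 fun b => ?_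
          have hψ := (mem_filter.1 hψ).2
          rw [Sigma.mk.injEq, heq_eq_eq] at hψ
          rw [← hψ.2, ← hψ.1, insert_erase (mem_image_of_mem _ (mem_univ a))]
          exact mem_image_of_mem _ (mem_univ b)
      _ = h ^ h := by rw [Fintype.card_piFinset_const, hcard]

lemma card_le_of_forall_sub_le {n : ℕ} {L : ℝ} (hL : 0 ≤ L) {s : Finset (Fin n)}
    (hs : ∀ v ∈ s, ∀ w ∈ s, ((v : ℕ) : ℝ) - ((w : ℕ) : ℝ) ≤ L) : (#s : ℝ) ≤ L + 1 := by
  obtain rfl | hne := s.eq_empty_or_nonempty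
  · simp only [card_empty, Nat.cast_zero]; linarith
  obtain ⟨w, hw, hmin⟩ := s.exists_min_image (fun v => (v : ℕ)) hne
  have : #s ≤ #(Icc (w : ℕ) (w + ⌊L⌋₊)) := by
    refine card_le_card_of_injOn (fun v => (v : ℕ)) (fun v hv => ?_)
      fun _ _ _ _ h => Fin.ext h
    have h1 := hs v hv w hw
    have h2 := hmin v hv
    have h3 : (v : ℕ) - (w : ℕ) ≤ ⌊L⌋₊ := Nat.le_floor (by rwa [Nat.cast_sub h2])
    rw [coe_Icc, Set.mem_Icc]
    dsimp only
    omega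
  rw [Nat.card_Icc] at this
  have h4 := Nat.floor_le hL
  have : (#s : ℝ) ≤ ⌊L⌋₊ + 1 := by exact_mod_cast (by omega : #s ≤ ⌊L⌋₊ + 1)
  linarith

open Classical in
/-- `[n]` splits into boundedly many intervals of length at most `ηn`, indexed by integers, such
that the one of index `0` contains the ball around `x`. -/
lemma exists_block_function {n M : ℕ} {η : ℝ} (hη : 0 < η) (hn : 2 ≤ η * n) (hM : 7 / η + 1 ≤ M)
    (x : Fin n) :
    ∃ β : Fin n → ℤ, Monotone β ∧ (∀ v, |β v| ≤ M) ∧ (∀ j, (#{v | β v = j} : ℝ) ≤ η * n) ∧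
      ∀ y : Fin n, |((y : ℕ) : ℝ) - ((x : ℕ) : ℝ)| ≤ η * n / 16 → β y = 0 := by
  have hn0 : (0 : ℝ) < n := by exact_mod_cast x.pos
  set L : ℝ := η * n / 7 with hLdef
  have hL : 0 < L := by positivity
  refine ⟨fun v => round ((((v : ℕ) : ℝ) - ((x : ℕ) : ℝ)) / L), fun v w hvw => ?_, fun v => ?_,
    fun j => ?_, fun y hy => ?_⟩
  · dsimp only
    rw [round_eq, round_eq]
    have : ((v : ℕ) : ℝ) ≤ ((w : ℕ) : ℝ) := by exact_mod_cast hvw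
    gcongr
  · have h1 := abs_sub_round ((((v : ℕ) : ℝ) - ((x : ℕ) : ℝ)) / L)
    have h2 : |(((v : ℕ) : ℝ) - ((x : ℕ) : ℝ)) / L| ≤ 7 / η := by
      rw [abs_div, abs_of_pos hL, div_le_div_iff₀ hL hη]
      have hv : ((v : ℕ) : ℝ) ≤ n := by exact_mod_cast v.isLt.le
      have hx : ((x : ℕ) : ℝ) ≤ n := by exact_mod_cast x.isLt.le
      have hv0 : (0 : ℝ) ≤ ((v : ℕ) : ℝ) := by positivity
      have hx0 : (0 : ℝ) ≤ ((x : ℕ) : ℝ) := by positivity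
      have : |((v : ℕ) : ℝ) - ((x : ℕ) : ℝ)| ≤ n := abs_le.2 ⟨by linarith, by linarith⟩
      rw [hLdef]
      nlinarith
    have h3 : |((round ((((v : ℕ) : ℝ) - ((x : ℕ) : ℝ)) / L) : ℤ) : ℝ)| ≤ M := by
      rw [abs_le] at *
      constructor <;> linarith
    exact_mod_cast h3
  · refine (card_le_of_forall_sub_le hL.le fun v hv w hw => ?_).trans (by rw [hLdef]; linarith)
    have hv : round ((((v : ℕ) : ℝ) - ((x : ℕ) : ℝ)) / L) = j := (mem_filter.1 hv).2
    have hw : round ((((w : ℕ) : ℝ) - ((x : ℕ) : ℝ)) / L) = j := (mem_filter.1 hw).2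
    have h1 := abs_le.1 (abs_sub_round ((((v : ℕ) : ℝ) - ((x : ℕ) : ℝ)) / L))
    have h2 := abs_le.1 (abs_sub_round ((((w : ℕ) : ℝ) - ((x : ℕ) : ℝ)) / L))
    rw [hv] at h1
    rw [hw] at h2
    have h3 : (((v : ℕ) : ℝ) - ((w : ℕ) : ℝ)) / L ≤ 1 := by
      have : (((v : ℕ) : ℝ) - ((w : ℕ) : ℝ)) / L =
        (((v : ℕ) : ℝ) - ((x : ℕ) : ℝ)) / L - (((w : ℕ) : ℝ) - ((x : ℕ) : ℝ)) / L := by ring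
      linarith [h1.2, h2.1]
    rwa [div_le_one hL] at h3
  · dsimp only
    rw [round_eq_zero_iff, Set.mem_Ico, le_div_iff₀ hL, div_lt_iff₀ hL]
    rw [abs_le] at hy
    have : 0 < η * n := by positivity
    constructor <;> rw [hLdef] <;> linarith

open Classical in
lemma le_card_ball {n : ℕ} {η : ℝ} (hη : 0 < η) (hη1 : η ≤ 1) (x : Fin n) :
    η * n / 16 ≤ #{y : Fin n | |((y : ℕ) : ℝ) - ((x : ℕ) : ℝ)| ≤ η * n / 16} := by
  set m := ⌊η * n / 16⌋₊ with hm
  have h0 : 0 ≤ η * n / 16 := by positivity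
  have hm1 : (m : ℝ) ≤ η * n / 16 := Nat.floor_le h0
  have hm2 : η * n / 16 < m + 1 := Nat.lt_floor_add_one _
  have hmn : 2 * m ≤ n := by
    have : (0 : ℝ) ≤ n := by positivity
    have : (2 * m : ℝ) ≤ n := by nlinarith
    exact_mod_cast this
  suffices hcard : m + 1 ≤ #{y : Fin n | |((y : ℕ) : ℝ) - ((x : ℕ) : ℝ)| ≤ η * n / 16} by
    have : ((m + 1 : ℕ) : ℝ) ≤ _ := Nat.cast_le.2 hcard
    push_cast at this
    linarith
  have hx := x.isLt
  have main : ∀ a : ℕ, a + m < n → a ≤ x → (x : ℕ) ≤ a + m →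
      m + 1 ≤ #{y : Fin n | |((y : ℕ) : ℝ) - ((x : ℕ) : ℝ)| ≤ η * n / 16} := by
    intro a ha hax hxa
    rw [← Fintype.card_fin (m + 1), ← card_univ]
    refine card_le_card_of_injOn (fun i => ⟨a + i, by omega⟩) (fun i _ => ?_) fun i _ j _ hij => ?_
    · simp only [coe_filter, mem_univ, true_and, Set.mem_ofPred_eq]
      refine le_trans ?_ hm1
      have h1 : a + (i : ℕ) ≤ x + m := by omega
      have h2 : (x : ℕ) ≤ a + i + m := by omega
      rw [abs_le]
      constructor
      · have : (((x : ℕ)) : ℝ) ≤ ((a + (i : ℕ) + m : ℕ) : ℝ) := Nat.cast_le.2 h2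
        push_cast at this ⊢
        linarith
      · have : ((a + (i : ℕ) : ℕ) : ℝ) ≤ (((x : ℕ) + m : ℕ) : ℝ) := Nat.cast_le.2 h1
        push_cast at this ⊢
        linarith
    · simp only [Fin.mk.injEq] at hij
      exact Fin.ext (by omega)
  by_cases hlt : (x : ℕ) + m < n
  · exact main x hlt le_rfl (by omega)
  · exact main (x - m) (by omega) (by omega) (by omega)

open Classical in
/-- If every vertex of `B` has few sets connecting it to `x`, then `B` is small. -/
lemma card_lt_of_few_connectingSets {h n M : ℕ} {H : SimpleGraph (Fin h)}
    {col : Fin h → Fin (intervalChi H)} (hcol : Monotone col)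
    (hH : ∀ i j, H.Adj i j → col i ≠ col j) (hsurj : Function.Surjective col)
    {k : ℕ} (hk : intervalChi H = k + 1)
    {η κ δ : ℝ} (hη : 0 < η) (hκ : 0 < κ)
    (hM : 7 / η + 1 ≤ M) (hn : 2 ≤ η * n)
    (hδ : δ = (κ * η ^ k / (2 * M + 1) ^ intervalChi H) ^
      (∏ k, Fintype.card {a // col a = k}))
    (hnδ : 2 * (h : ℝ) ^ 2 ≤ δ * n) {G : SimpleGraph (Fin n)}
    (hG : ∀ v, (1 - 1 / (intervalChi H : ℝ) + η) * n ≤ odeg G v) {x : Fin n}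
    {B : Finset (Fin n)} (hxB : x ∉ B)
    (hB : ∀ y ∈ B, |((y : ℕ) : ℝ) - ((x : ℕ) : ℝ)| ≤ η * n / 16)
    (hfew : ∀ y ∈ B, (#{X | IsConnectingSet H G x y X} : ℝ) ≤
      δ / (4 * h ^ h) * n ^ (h - 1)) :
    #B < κ * n := by
  by_contra! hcon
  have hn0 : (0 : ℝ) < n := by exact_mod_cast x.pos
  obtain ⟨β, hβ, hβM, hfib, hball⟩ := exists_block_function hη hn hM x
  have hx0 : β x = 0 := hball x (by simp only [sub_self, abs_zero]; positivity)
  have hε : 0 < κ * η ^ k := by positivity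
  have hT : κ * η ^ k * n ^ intervalChi H ≤
      #{u : Fin (intervalChi H) → Fin n | IsGoodClique G β B x u} := by
    have := le_card_goodClique (k := k) hη hk.ge hG hfib (fun y hy => hball y (hB y hy)) (x := x)
    rw [← hk] at this
    refine le_trans ?_ this
    calc _ = κ * n * (η * n) ^ k := by rw [hk]; ring
      _ ≤ _ := by gcongr
  obtain ⟨c, hc, ⟨a, ha⟩, hP⟩ := exists_many_blockHoms x.pos hε hsurj hβM hT
  rw [← hδ] at hP
  have hδ0 : 0 < δ := by rw [hδ]; positivity
  have hh : 0 < h := a.pos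
  have hsplit : #{ψ : Fin h → Fin n | IsBlockHom G β B x col c ψ} ≤
      h ^ h * ∑ y ∈ B, #{X | IsConnectingSet H G x y X} + h ^ 2 * n ^ (h - 1) := by
    refine le_trans ?_ (add_le_add (card_injective_blockHom_le hcol hH hβ hc hxB hx0 ha)
      (card_not_injective_le h n))
    refine le_trans (card_le_card fun ψ hψ => ?_) (card_union_le _ _)
    simp only [mem_union, mem_filter, mem_univ, true_and] at hψ ⊢
    by_cases hi : Function.Injective ψ
    · exact Or.inl ⟨hψ, hi⟩
    · exact Or.inr hi
  have hsum : ∑ y ∈ B, (#{X | IsConnectingSet H G x y X} : ℝ) ≤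
      n * (δ / (4 * h ^ h) * n ^ (h - 1)) := by
    refine (sum_le_sum hfew).trans ?_
    rw [sum_const, nsmul_eq_mul]
    gcongr
    simpa using card_le_univ B
  have hpow : (n : ℝ) ^ h = n * n ^ (h - 1) := by rw [← pow_succ', Nat.sub_add_cancel hh]
  have hsplit' : δ * (n : ℝ) ^ h ≤
      h ^ h * (n * (δ / (4 * h ^ h) * n ^ (h - 1))) + h ^ 2 * n ^ (h - 1) := by
    refine hP.trans ((Nat.cast_le.2 hsplit).trans ?_)
    push_cast
    gcongr
  have hhh : (0 : ℝ) < (h : ℝ) ^ h := by positivity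
  have e1 : (h : ℝ) ^ h * (n * (δ / (4 * h ^ h) * n ^ (h - 1))) = δ / 4 * (n * n ^ (h - 1)) := by
    field_simp
  rw [e1, hpow] at hsplit'
  have hp : (0 : ℝ) < (n : ℝ) ^ (h - 1) := by positivity
  have e2 : 2 * (h : ℝ) ^ 2 * n ^ (h - 1) ≤ δ * n * n ^ (h - 1) := by gcongr
  have e3 : 0 < δ * n * (n : ℝ) ^ (h - 1) := by positivity
  linarith

theorem connecting_lemma (h : ℕ) :
    ∃ η₀ : ℝ, 0 < η₀ ∧
      ∀ H : SimpleGraph (Fin h), (∃ a b : Fin h, H.Adj a b) →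
      ∀ η : ℝ, 0 < η → η ≤ η₀ → ∀ γ : ℝ, 0 < γ →
      ∃ (n₀ : ℕ) (ρ : ℝ), 0 < ρ ∧ ∀ n : ℕ, n₀ ≤ n → ∀ G : SimpleGraph (Fin n),
        (∀ v : Fin n, (1 - 1 / (intervalChi H : ℝ) + η) * n ≤ (odeg G v : ℝ)) →
        ∀ x : Fin n,
          (1 - γ) *
              ({y : Fin n | |((y : ℕ) : ℝ) - ((x : ℕ) : ℝ)| ≤ η * n / 16}.ncard : ℝ) ≤
            ({y : Fin n | |((y : ℕ) : ℝ) - ((x : ℕ) : ℝ)| ≤ η * n / 16 ∧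
              ρ * (n : ℝ) ^ (h - 1) ≤
                ({X : Finset (Fin n) | x ∉ X ∧ y ∉ X ∧ X.card = h - 1 ∧
                  IsCopySet H G (insert x X) ∧
                  IsCopySet H G (insert y X)}.ncard : ℝ)}.ncard : ℝ) := by
  classical
  refine ⟨1, one_pos, fun H ⟨a₀, _, _⟩ η hη hη1 γ hγ => ?_⟩
  obtain ⟨col, hcol, hH, hsurj⟩ := exists_surjective_intervalColoring H
  obtain ⟨k, hk⟩ : ∃ k, intervalChi H = k + 1 :=
    ⟨intervalChi H - 1, by have := (col a₀).pos; omega⟩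
  obtain ⟨M, hM⟩ := exists_nat_ge (7 / η + 1)
  set κ : ℝ := γ * η / 32 with hκdef
  have hκ : 0 < κ := by positivity
  obtain ⟨δ, hδ⟩ : ∃ δ : ℝ, δ = (κ * η ^ k / (2 * M + 1) ^ intervalChi H) ^
    (∏ k, Fintype.card {a // col a = k}) := ⟨_, rfl⟩
  have hδ0 : 0 < δ := by rw [hδ]; positivity
  have hh : 0 < h := a₀.pos
  obtain ⟨n₁, hn₁⟩ := exists_nat_ge (2 / η)
  obtain ⟨n₂, hn₂⟩ := exists_nat_ge (2 * (h : ℝ) ^ 2 / δ)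
  obtain ⟨n₃, hn₃⟩ := exists_nat_ge (1 / κ)
  refine ⟨max n₁ (max n₂ n₃), δ / (4 * h ^ h), by positivity, fun n hn G hG x => ?_⟩
  simp only [max_le_iff] at hn
  have bound : ∀ {a b : ℝ} {m : ℕ}, 0 < b → a / b ≤ m → m ≤ n → a ≤ b * n := by
    intro a b m hb ham hmn
    rw [div_le_iff₀' hb] at ham
    have : (m : ℝ) ≤ n := Nat.cast_le.2 hmn
    exact ham.trans (by gcongr)
  set ball : Finset (Fin n) := {y | |((y : ℕ) : ℝ) - ((x : ℕ) : ℝ)| ≤ η * n / 16}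
  set good : Finset (Fin n) := ball.filter fun y =>
    δ / (4 * h ^ h) * (n : ℝ) ^ (h - 1) ≤ #{X | IsConnectingSet H G x y X}
  set bad : Finset (Fin n) := (ball \ good).erase x with hbad
  have hballcard : η * n / 16 ≤ #ball := le_card_ball hη hη1 x
  have hbadcard : #bad < κ * n := by
    refine card_lt_of_few_connectingSets hcol hH hsurj hk hη hκ hM (bound hη hn₁ hn.1) hδ
      (bound hδ0 hn₂ hn.2.1) hG (notMem_erase x _) (fun y hy => ?_) fun y hy => ?_
    · exact (mem_filter.1 (mem_sdiff.1 (mem_of_mem_erase hy)).1).2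
    · obtain ⟨hy1, hy2⟩ := mem_sdiff.1 (mem_of_mem_erase hy)
      by_contra! hlt
      exact hy2 (mem_filter.2 ⟨hy1, hlt.le⟩)
  have hsplit : (#ball : ℝ) ≤ #good + (#bad + 1) := by
    have h1 : #(ball \ good) + #good = #ball := card_sdiff_add_card_eq_card (filter_subset _ _)
    have h2 : #(ball \ good) ≤ #bad + 1 := by
      rw [hbad, card_erase_eq_ite]
      split_ifs <;> omega
    exact_mod_cast (by omega : #ball ≤ #good + (#bad + 1))
  have hball : {y : Fin n | |((y : ℕ) : ℝ) - ((x : ℕ) : ℝ)| ≤ η * n / 16}.ncard = #ball := by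
    rw [← Set.ncard_coe_finset, coe_filter_univ]
  have hgood : {y : Fin n | |((y : ℕ) : ℝ) - ((x : ℕ) : ℝ)| ≤ η * n / 16 ∧
      δ / (4 * h ^ h) * (n : ℝ) ^ (h - 1) ≤
        ({X : Finset (Fin n) | x ∉ X ∧ y ∉ X ∧ X.card = h - 1 ∧
          IsCopySet H G (insert x X) ∧
          IsCopySet H G (insert y X)}.ncard : ℝ)}.ncard = #good := by
    rw [← Set.ncard_coe_finset]
    congr 1
    ext y
    have hconn : {X : Finset (Fin n) | x ∉ X ∧ y ∉ X ∧ X.card = h - 1 ∧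
        IsCopySet H G (insert x X) ∧ IsCopySet H G (insert y X)}.ncard =
        #{X | IsConnectingSet H G x y X} := by
      rw [← Set.ncard_coe_finset, coe_filter_univ]
      rfl
    simp only [Set.mem_ofPred_eq, hconn, good, ball, coe_filter, mem_filter, mem_univ, true_and]
  rw [hball, hgood]
  have h3 : 1 ≤ κ * n := bound hκ hn₃ hn.2.2
  have h4 : γ * (η * n / 16) ≤ γ * #ball := by gcongr
  have h5 : κ * n + κ * n = γ * (η * n / 16) := by rw [hκdef]; ring
  linarith
end
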